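/- Let ε ≥ 0 and let ρ₀, ρ₁ be positive definite density matrices in M_n(ℂ). Under the standing assumptions (detailed balance with respect to an invertible density matrix σ and ergodicity of L), the entropically regularized noncommutative transport distance satisfies the duality formula ½·W_ε²(ρ₀,ρ₁) = sup{ τ(A(1)ρ₁ − A(0)ρ₀) : A an HJB_ε subsolution }. -/

import Mathlib

open MeasureTheory Matrix
open scoped ENNReal Classical ComplexOrder

/-- Normalized trace `τ(A) = Tr(A)/n` on `M_n(ℂ)`. -/
noncomputable def tau {N : Type*} [Fintype N] (A : Matrix N N ℂ) : ℂ :=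
  A.trace / (Fintype.card N)

/-- GNS inner product `⟨A,B⟩ = τ(A* B)`, conjugate-linear in the first argument. -/
noncomputable def gns {N : Type*} [Fintype N] (A B : Matrix N N ℂ) : ℂ := tau (Aᴴ * B)

/-- Fractional power `X^s` of a positive semidefinite matrix via functional calculus
(junk value `0` if `X` is not hermitian). -/
noncomputable def mpow {N : Type*} [Fintype N] [DecidableEq N] (X : Matrix N N ℂ) (s : ℝ) :
    Matrix N N ℂ :=
  if hX : X.IsHermitian then
    (Matrix.IsHermitian.eigenvectorUnitary hX : Matrix N N ℂ) *
      Matrix.diagonal (fun i => ((hX.eigenvalues i ^ s : ℝ) : ℂ)) *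
      (star (Matrix.IsHermitian.eigenvectorUnitary hX : Matrix N N ℂ))
  else 0

/-- The operator `[X]_α(A) = ∫₀¹ e^{α(s-1/2)} X^s A X^{1-s} ds` on `M_n(ℂ)`. -/
noncomputable def sandwich {N : Type*} [Fintype N] [DecidableEq N] (X : Matrix N N ℂ) (α : ℝ)
    (A : Matrix N N ℂ) : Matrix N N ℂ :=
  Matrix.of fun i k =>
    ∫ s in (0:ℝ)..1, Real.exp (α * (s - 1/2)) • ((mpow X s * A * mpow X (1 - s)) i k)

section H

variable {N : Type*} [Fintype N] [DecidableEq N] {J : Type*} [Fintype J]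

/-- Inner product on `H = ⊕_{j ∈ J} M_n(ℂ)`. -/
noncomputable def gnsH (V W : J → Matrix N N ℂ) : ℂ := ∑ j, gns (V j) (W j)

/-- The operator `[ρ]_ω = ⊕_j [ρ]_{ω_j}` on `H`. -/
noncomputable def opOmega (ω : J → ℝ) (ρ : Matrix N N ℂ) (W : J → Matrix N N ℂ) :
    J → Matrix N N ℂ :=
  fun j => sandwich ρ (ω j) (W j)

/-- Extended value `⟨V, K⁻¹ V⟩ ∈ [0,∞]`: equals `⟨W, K W⟩` if `V = K W` with
`W ⊥ ker K`, and `∞` if `V ∉ ran K`. -/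
noncomputable def invQuadH (K : (J → Matrix N N ℂ) → (J → Matrix N N ℂ))
    (V : J → Matrix N N ℂ) : ℝ≥0∞ :=
  if h : ∃ W, K W = V ∧ ∀ U, K U = 0 → gnsH W U = 0
  then ENNReal.ofReal (gnsH h.choose (K h.choose)).re
  else ⊤

/-- The partial derivative `∂_j A = [V_j, A]`; `gradD V A = ∇A`. -/
noncomputable def gradD (Vf : J → Matrix N N ℂ) (A : Matrix N N ℂ) : J → Matrix N N ℂ :=
  fun j => Vf j * A - A * Vf j

/-- The Lindblad generator `L(A) = ∑_j (e^{-ω_j/2} V_j^*[A,V_j] - e^{ω_j/2}[A,V_j]V_j^*)`. -/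
noncomputable def genL (Vf : J → Matrix N N ℂ) (ω : J → ℝ) (A : Matrix N N ℂ) :
    Matrix N N ℂ :=
  ∑ j, (Real.exp (-ω j / 2) • ((Vf j)ᴴ * (A * Vf j - Vf j * A)) -
        Real.exp (ω j / 2) • ((A * Vf j - Vf j * A) * (Vf j)ᴴ))

/-- Membership in `CE_ε(ρ₀,ρ₁)`: `ρ` is a C¹ curve of invertible density matrices joining
`ρ₀` to `ρ₁`, `Vc` is continuous, and the continuity equation
`ρ'(t) + div Vc(t) = ε L†ρ(t)` holds on `[0,1]`. -/
def IsCE (dvg : (J → Matrix N N ℂ) → Matrix N N ℂ) (Ldag : Matrix N N ℂ → Matrix N N ℂ)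
    (ε : ℝ) (ρ₀ ρ₁ : Matrix N N ℂ) (ρ : ℝ → Matrix N N ℂ) (Vc : ℝ → J → Matrix N N ℂ) :
    Prop :=
  ρ 0 = ρ₀ ∧ ρ 1 = ρ₁ ∧
  (∀ t ∈ Set.Icc (0:ℝ) 1, (ρ t).PosDef ∧ tau (ρ t) = 1) ∧
  (∀ j i k, ContinuousOn (fun t => Vc t j i k) (Set.Icc (0:ℝ) 1)) ∧
  ∃ ρ' : ℝ → Matrix N N ℂ,
    (∀ t ∈ Set.Icc (0:ℝ) 1, ∀ i k, HasDerivAt (fun s => ρ s i k) (ρ' t i k) t) ∧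
    (∀ i k, ContinuousOn (fun t => ρ' t i k) (Set.Icc (0:ℝ) 1)) ∧
    (∀ t ∈ Set.Icc (0:ℝ) 1, ρ' t + dvg (Vc t) = ε • Ldag (ρ t))

/-- The squared entropic transport distance `W_ε²(ρ₀,ρ₁)`. -/
noncomputable def Wsq (ω : J → ℝ) (dvg : (J → Matrix N N ℂ) → Matrix N N ℂ)
    (Ldag : Matrix N N ℂ → Matrix N N ℂ) (ε : ℝ) (ρ₀ ρ₁ : Matrix N N ℂ) : ℝ≥0∞ :=
  ⨅ (ρ : ℝ → Matrix N N ℂ) (Vc : ℝ → J → Matrix N N ℂ)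
    (_ : IsCE dvg Ldag ε ρ₀ ρ₁ ρ Vc),
      ∫⁻ t in Set.Icc (0:ℝ) 1, invQuadH (opOmega ω (ρ t)) (Vc t)

/-- Hamilton–Jacobi–Bellmann subsolutions: `A` is a C¹ curve of hermitian matrices with
`τ((Ȧ(t) + ε L A(t))ρ) + ½⟨∇A(t), [ρ]_ω ∇A(t)⟩ ≤ 0` for all `t ∈ [0,1]` and all
density matrices `ρ`.  (`A'` records the derivative of `A`.) -/
noncomputable def IsHJB (Vf : J → Matrix N N ℂ) (ω : J → ℝ) (ε : ℝ)
    (A A' : ℝ → Matrix N N ℂ) : Prop :=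
  (∀ t ∈ Set.Icc (0:ℝ) 1, (A t).IsHermitian) ∧
  (∀ t ∈ Set.Icc (0:ℝ) 1, ∀ i k, HasDerivAt (fun s => A s i k) (A' t i k) t) ∧
  (∀ i k, ContinuousOn (fun t => A' t i k) (Set.Icc (0:ℝ) 1)) ∧
  ∀ t ∈ Set.Icc (0:ℝ) 1, ∀ ρ : Matrix N N ℂ, ρ.PosSemidef → tau ρ = 1 →
    (tau ((A' t + ε • genL Vf ω (A t)) * ρ)).re
      + (1/2) * (gnsH (gradD Vf (A t)) (opOmega ω ρ (gradD Vf (A t)))).re ≤ 0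

end H

set_option linter.unusedSectionVars false

/-- A convex dynamic transport problem on finite-dimensional real spaces: states `x ∈ Ω ⊆ F`,
fluxes `v ∈ H`, the continuity equation `x' + D v = Λ x + b`, and a Lagrangian `q`, jointly convex,
quadratic and coercive in the flux. -/
structure TransportProblem (F H : Type*) [NormedAddCommGroup F] [NormedSpace ℝ F]
    [NormedAddCommGroup H] [NormedSpace ℝ H] where
  Ω : Set F
  D : H →L[ℝ] F
  Λ : F →L[ℝ] F
  b : F
  q : F → H → ℝ
  c : ℝ
  isOpen : IsOpen Ω
  isBounded : Bornology.IsBounded Ω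
  surjective : Function.Surjective D
  convexOn : ConvexOn ℝ (Ω ×ˢ Set.univ) (fun p : F × H => q p.1 p.2)
  homogeneous : ∀ x ∈ Ω, ∀ (r : ℝ) (v : H), q x (r • v) = r ^ 2 * q x v
  c_pos : 0 < c
  coercive : ∀ x ∈ Ω, ∀ v, c * ‖v‖ ^ 2 ≤ q x v

namespace TransportProblem

variable {F H : Type*} [NormedAddCommGroup F] [NormedSpace ℝ F] [FiniteDimensional ℝ F]
  [NormedAddCommGroup H] [NormedSpace ℝ H] [FiniteDimensional ℝ H] (T : TransportProblem F H)

/-- Admissible curves: `x` is `C¹` with values in `Ω`, `v` is continuous. -/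
structure Admissible (x : ℝ → F) (v : ℝ → H) : Prop where
  contDiff : ContDiff ℝ 1 x
  continuous : Continuous v
  mem : ∀ t, x t ∈ T.Ω

/-- The defect in the continuity equation. -/
noncomputable def defect (x : ℝ → F) (v : ℝ → H) (t : ℝ) : F :=
  deriv x t + T.D (v t) - (T.Λ (x t) + T.b)

/-- `P` is a lower bound for the action of admissible solutions of the continuity equation
joining `x₀` to `x₁`. -/
def IsLowerBound (x₀ x₁ : F) (P : ℝ) : Prop :=
  ∀ x v, T.Admissible x v → x 0 = x₀ → x 1 = x₁ → (∀ t ∈ Set.Icc (0:ℝ) 1, T.defect x v t = 0) →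
    P ≤ ∫ t in (0:ℝ)..1, T.q (x t) (v t)

variable {T}

lemma convex_Ω : Convex ℝ T.Ω := by
  have := T.convexOn.1
  intro x hx y hy a b ha hb hab
  exact (this (show (x, (0:H)) ∈ _ from ⟨hx, trivial⟩) (show (y, (0:H)) ∈ _ from ⟨hy, trivial⟩)
    ha hb hab).1

lemma q_nonneg {x : F} (hx : x ∈ T.Ω) (v : H) : 0 ≤ T.q x v :=
  le_trans (mul_nonneg T.c_pos.le (sq_nonneg _)) (T.coercive x hx v)

lemma continuousOn_q : ContinuousOn (fun p : F × H => T.q p.1 p.2) (T.Ω ×ˢ Set.univ) :=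
  T.convexOn.continuousOn (T.isOpen.prod isOpen_univ)

lemma continuous_q_comp {X : Type*} [TopologicalSpace X] {x : X → F} {v : X → H}
    (hx : Continuous x) (hv : Continuous v) (hmem : ∀ t, x t ∈ T.Ω) :
    Continuous fun t => T.q (x t) (v t) :=
  T.continuousOn_q.comp_continuous (hx.prodMk hv) fun t => ⟨hmem t, trivial⟩

lemma Admissible.continuous_defect {x : ℝ → F} {v : ℝ → H} (h : T.Admissible x v) :
    Continuous (T.defect x v) := by
  have h1 := h.contDiff.continuous_deriv (le_refl _)
  have h2 := h.contDiff.continuous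
  have h3 := h.continuous
  unfold defect
  fun_prop

variable (T) in
lemma exists_rightInverse : ∃ R : F →L[ℝ] H, ∀ y, T.D (R y) = y := by
  obtain ⟨g, hg⟩ := (T.D : H →ₗ[ℝ] F).exists_rightInverse_of_surjective
    (LinearMap.range_eq_top.2 T.surjective)
  exact ⟨LinearMap.toContinuousLinearMap g, fun y => LinearMap.congr_fun hg y⟩

lemma exists_admissible {x₀ x₁ : F} (h₀ : x₀ ∈ T.Ω) (h₁ : x₁ ∈ T.Ω) :
    ∃ x : ℝ → F, T.Admissible x 0 ∧ x 0 = x₀ ∧ x 1 = x₁ := by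
  refine ⟨fun t => (1 - Real.smoothTransition t) • x₀ + Real.smoothTransition t • x₁,
    ⟨?_, continuous_const, fun t => ?_⟩, by simp, by simp⟩
  · have := Real.smoothTransition.contDiff (n := 1)
    fun_prop
  · exact convex_Ω h₀ h₁ (sub_nonneg.2 (Real.smoothTransition.le_one t))
      (Real.smoothTransition.nonneg t) (by ring)

/-- The strict epigraph of the value function of the problem with perturbed continuity equation. -/
def perturbationEpigraph (T : TransportProblem F H) (x₀ x₁ : F) : Set (C(unitInterval, F) × ℝ) :=
  {p | ∃ x v, T.Admissible x v ∧ x 0 = x₀ ∧ x 1 = x₁ ∧ (∀ t : unitInterval, p.1 t = T.defect x v t) ∧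
    ∫ t in (0:ℝ)..1, T.q (x t) (v t) < p.2}

lemma convex_perturbationEpigraph (x₀ x₁ : F) : Convex ℝ (T.perturbationEpigraph x₀ x₁) := by
  rintro ⟨g, r⟩ ⟨x, v, h, hx0, hx1, hg, hr⟩ ⟨g', r'⟩ ⟨x', v', h', hx0', hx1', hg', hr'⟩ a b ha hb hab
  have hxd := h.contDiff
  have hxd' := h'.contDiff
  have hv := h.continuous
  have hv' := h'.continuous
  have hadm : T.Admissible (fun t => a • x t + b • x' t) (fun t => a • v t + b • v' t) :=
    ⟨by fun_prop, by fun_prop, fun t => convex_Ω (h.mem t) (h'.mem t) ha hb hab⟩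
  refine ⟨_, _, hadm, ?_, ?_, fun t => ?_, ?_⟩
  · rw [hx0, hx0', ← add_smul, hab, one_smul]
  · rw [hx1, hx1', ← add_smul, hab, one_smul]
  · have e1 := (hxd.differentiable one_ne_zero).differentiableAt (x := (t : ℝ))
    have e2 := (hxd'.differentiable one_ne_zero).differentiableAt (x := (t : ℝ))
    simp only [Prod.smul_mk, Prod.mk_add_mk, ContinuousMap.add_apply, ContinuousMap.smul_apply] at *
    rw [hg, hg']
    have : deriv (fun t => a • x t + b • x' t) (t : ℝ) = a • deriv x t + b • deriv x' t := by
      rw [deriv_fun_add (by fun_prop) (by fun_prop), deriv_fun_const_smul _ e1,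
        deriv_fun_const_smul _ e2]
    simp only [defect, this, map_add, map_smul]
    have hb' : T.b = a • T.b + b • T.b := by rw [← add_smul, hab, one_smul]
    nth_rw 3 [hb']
    module
  · have c1 := continuous_q_comp hxd.continuous hv h.mem
    have c2 := continuous_q_comp hxd'.continuous hv' h'.mem
    have c3 := continuous_q_comp hadm.contDiff.continuous hadm.continuous hadm.mem
    have : ∫ t in (0:ℝ)..1, T.q (a • x t + b • x' t) (a • v t + b • v' t) ≤
        ∫ t in (0:ℝ)..1, (a * T.q (x t) (v t) + b * T.q (x' t) (v' t)) := by
      apply intervalIntegral.integral_mono_on zero_le_one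
        (c3.intervalIntegrable _ _) (Continuous.intervalIntegrable (by fun_prop) _ _)
      intro t _
      exact T.convexOn.2 (show (x t, v t) ∈ _ from ⟨h.mem t, trivial⟩)
        (show (x' t, v' t) ∈ _ from ⟨h'.mem t, trivial⟩) ha hb hab
    rw [intervalIntegral.integral_add (Continuous.intervalIntegrable (by fun_prop) _ _)
      (Continuous.intervalIntegrable (by fun_prop) _ _), intervalIntegral.integral_const_mul,
      intervalIntegral.integral_const_mul] at this
    refine this.trans_lt ?_
    simp only [Prod.smul_mk, Prod.mk_add_mk, smul_eq_mul] at *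
    rcases ha.eq_or_lt with rfl | ha'
    · have : b = 1 := by linarith
      subst this; simpa using hr'
    · exact add_lt_add_of_lt_of_le (mul_lt_mul_of_pos_left hr ha')
        (mul_le_mul_of_nonneg_left hr'.le hb)

lemma isOpen_perturbationEpigraph (x₀ x₁ : F) : IsOpen (T.perturbationEpigraph x₀ x₁) := by
  obtain ⟨R, hR⟩ := T.exists_rightInverse
  rw [isOpen_iff_mem_nhds]
  rintro ⟨g, r⟩ ⟨x, v, h, hx0, hx1, hg, hr⟩
  have hv := h.continuous
  have hx := h.contDiff.continuous
  let pr : ℝ → unitInterval := Set.projIcc 0 1 zero_le_one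
  have hpr : Continuous pr := continuous_projIcc
  have hΦ : Continuous fun g' : C(unitInterval, F) =>
      ∫ t in (0:ℝ)..1, T.q (x t) (v t + R (g' (pr t) - g (pr t))) := by
    apply intervalIntegral.continuous_parametric_intervalIntegral_of_continuous'
    refine continuous_q_comp (by fun_prop) ?_ fun p => h.mem p.2
    have : Continuous fun p : C(unitInterval, F) × ℝ => p.1 (pr p.2) :=
      continuous_fst.eval (hpr.comp continuous_snd)
    fun_prop
  have hlt : ∀ᶠ p : C(unitInterval, F) × ℝ in nhds (g, r),
      ∫ t in (0:ℝ)..1, T.q (x t) (v t + R (p.1 (pr t) - g (pr t))) < p.2 := by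
    refine (hΦ.comp continuous_fst).continuousAt.eventually_lt continuous_snd.continuousAt ?_
    simpa using hr
  filter_upwards [hlt] with p hp
  refine ⟨x, fun t => v t + R (p.1 (pr t) - g (pr t)), ⟨h.contDiff, by fun_prop, h.mem⟩, hx0, hx1,
    fun t => ?_, hp⟩
  have hpt : pr t = t := Set.projIcc_val _ t
  have := hg t
  simp only [defect, map_add, hR, hpt] at this ⊢
  rw [this]
  abel

/-- A subgradient, at the unperturbed continuity equation, of the value function. -/
lemma IsLowerBound.exists_functional {x₀ x₁ : F} {P : ℝ} (hP : T.IsLowerBound x₀ x₁ P)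
    (h₀ : x₀ ∈ T.Ω) (h₁ : x₁ ∈ T.Ω) :
    ∃ ℓ : C(unitInterval, F) →L[ℝ] ℝ, ∀ x v, T.Admissible x v → x 0 = x₀ → x 1 = x₁ →
      ∀ g : C(unitInterval, F), (∀ t : unitInterval, g t = T.defect x v t) →
        P + ℓ g ≤ ∫ t in (0:ℝ)..1, T.q (x t) (v t) := by
  have hnot : ((0 : C(unitInterval, F)), P) ∉ T.perturbationEpigraph x₀ x₁ := by
    rintro ⟨x, v, h, hx0, hx1, hg, hr⟩
    exact absurd hr (not_lt.2 (hP x v h hx0 hx1 fun t ht => (hg ⟨t, ht⟩).symm))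
  obtain ⟨f, hf⟩ := geometric_hahn_banach_open_point (convex_perturbationEpigraph x₀ x₁)
    (isOpen_perturbationEpigraph x₀ x₁) hnot
  obtain ⟨R, hR⟩ := T.exists_rightInverse
  have hsplit : ∀ g r, f (g, r) = f (g, 0) + r * f (0, 1) := by
    intro g r
    have : ((g, r) : C(unitInterval, F) × ℝ) = (g, 0) + r • ((0 : C(unitInterval, F)), (1:ℝ)) := by
      ext <;> simp
    rw [this, map_add, map_smul, smul_eq_mul]
  set β := f (0, 1) with hβ
  have hβneg : β < 0 := by
    obtain ⟨x, hx, hx0, hx1⟩ := T.exists_admissible h₀ h₁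
    have hd := hx.contDiff
    have hd' := hd.continuous_deriv le_rfl
    have hd'' := hd.continuous
    let v : ℝ → H := fun t => R (T.Λ (x t) + T.b - deriv x t)
    let r := max P (∫ t in (0:ℝ)..1, T.q (x t) (v t)) + 1
    have hmem : ((0 : C(unitInterval, F)), r) ∈ T.perturbationEpigraph x₀ x₁ := by
      refine ⟨x, v, ⟨hd, by fun_prop, hx.mem⟩, hx0, hx1, fun t => ?_, ?_⟩
      · simp only [defect, v, hR, ContinuousMap.zero_apply]
        abel
      · exact lt_of_le_of_lt (le_max_right P _) (lt_add_one _)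
    have h1 := hf _ hmem
    rw [hsplit 0 r, hsplit 0 P] at h1
    have h2 : P < r := lt_of_le_of_lt (le_max_left _ _) (lt_add_one _)
    by_contra hcon
    nlinarith [mul_le_mul_of_nonneg_right h2.le (not_lt.1 hcon)]
  refine ⟨(-β)⁻¹ • f.comp (ContinuousLinearMap.inl ℝ _ _), fun x v h hx0 hx1 g hg => ?_⟩
  refine le_of_forall_gt_imp_ge_of_dense fun r hr => ?_
  have h1 := hf (g, r) ⟨x, v, h, hx0, hx1, hg, hr⟩
  have h0 : f (0, 0) = 0 := map_zero f
  rw [hsplit g r, hsplit 0 P, h0] at h1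
  have h2 : (-β)⁻¹ * f (g, 0) < r - P := by
    rw [inv_mul_lt_iff₀ (by linarith)]
    linarith
  simp only [_root_.smul_apply, ContinuousLinearMap.comp_apply,
    ContinuousLinearMap.inl_apply, smul_eq_mul]
  linarith

end TransportProblem

section Mollification

variable {F : Type*} [NormedAddCommGroup F] [NormedSpace ℝ F]

/-- Multiplication of a scalar function by a constant vector. -/
noncomputable def smulConstCLM (F : Type*) [NormedAddCommGroup F] [NormedSpace ℝ F] :
    C(unitInterval, ℝ) →L[ℝ] F →L[ℝ] C(unitInterval, F) :=
  LinearMap.mkContinuous₂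
    (LinearMap.mk₂ ℝ (fun (k : C(unitInterval, ℝ)) (y : F) =>
        (⟨fun t => k t • y, by fun_prop⟩ : C(unitInterval, F)))
      (fun k k' y => by ext t; simp [add_smul]) (fun a k y => by ext t; simp [mul_smul])
      (fun k y y' => by ext t; simp) (fun a k y => by ext t; exact smul_comm _ _ _))
    1 (fun k y => by
      rw [one_mul, ContinuousMap.norm_le _ (by positivity)]
      intro t
      simp only [LinearMap.mk₂_apply, ContinuousMap.coe_mk, norm_smul]
      gcongr
      exact k.norm_coe_le_norm t)

@[simp] lemma smulConstCLM_apply (k : C(unitInterval, ℝ)) (y : F) (t : unitInterval) :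
    smulConstCLM F k y t = k t • y := rfl

/-- The curve `s ↦ φ (s - θ ·)` in `C([0,1])`. -/
noncomputable def shiftKernel (φ : C(ℝ, ℝ)) (θ : C(unitInterval, ℝ)) (s : ℝ) :
    C(unitInterval, ℝ) := ⟨fun t => φ (s - θ t), by fun_prop⟩

lemma continuous_shiftKernel (φ : C(ℝ, ℝ)) (θ : C(unitInterval, ℝ)) :
    Continuous (shiftKernel φ θ) := by
  apply ContinuousMap.continuous_of_continuous_uncurry
  simp only [shiftKernel, ContinuousMap.coe_mk, Function.uncurry_def]
  fun_prop

lemma hasDerivAt_shiftKernel {φ φ' : C(ℝ, ℝ)} (h : ∀ s, HasDerivAt φ (φ' s) s)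
    (θ : C(unitInterval, ℝ)) (s : ℝ) :
    HasDerivAt (shiftKernel φ θ) (shiftKernel φ' θ s) s := by
  have hc := continuous_shiftKernel φ' θ
  have key : shiftKernel φ θ = fun s =>
      shiftKernel φ θ 0 + ∫ r in (0:ℝ)..s, shiftKernel φ' θ r := by
    ext s t
    have e := ContinuousLinearMap.intervalIntegral_comp_comm (ContinuousMap.evalCLM ℝ t)
      (hc.intervalIntegrable (μ := volume) 0 s)
    simp only [ContinuousMap.evalCLM_apply] at e
    rw [ContinuousMap.add_apply, ← e]
    simp only [shiftKernel, ContinuousMap.coe_mk]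
    rw [intervalIntegral.integral_eq_sub_of_hasDerivAt (f := fun r => φ (r - θ t))
      (fun r _ => by simpa using! (h (r - θ t)).comp_sub_const r (θ t))
      (Continuous.intervalIntegrable (by fun_prop) _ _)]
    ring
  rw [key]
  exact (intervalIntegral.integral_hasDerivAt_right (hc.intervalIntegrable _ _)
    (hc.stronglyMeasurableAtFilter _ _) hc.continuousAt).const_add _

/-- Smoothing of a functional on `C([0,1], F)` by a kernel. -/
noncomputable def mollify (ℓ : C(unitInterval, F) →L[ℝ] ℝ) (φ : C(ℝ, ℝ)) (θ : C(unitInterval, ℝ))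
    (s : ℝ) : F →L[ℝ] ℝ := ℓ.comp (smulConstCLM F (shiftKernel φ θ s))

lemma continuous_mollify (ℓ : C(unitInterval, F) →L[ℝ] ℝ) (φ : C(ℝ, ℝ))
    (θ : C(unitInterval, ℝ)) : Continuous (mollify ℓ φ θ) :=
  (ContinuousLinearMap.compL ℝ F _ ℝ ℓ).continuous.comp
    ((smulConstCLM F).continuous.comp (continuous_shiftKernel φ θ))

lemma hasDerivAt_mollify (ℓ : C(unitInterval, F) →L[ℝ] ℝ) {φ φ' : C(ℝ, ℝ)}
    (h : ∀ s, HasDerivAt φ (φ' s) s) (θ : C(unitInterval, ℝ)) (s : ℝ) :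
    HasDerivAt (mollify ℓ φ θ) (mollify ℓ φ' θ s) s :=
  HasFDerivAt.comp_hasDerivAt (l := ⇑((ContinuousLinearMap.compL ℝ F _ ℝ ℓ).comp (smulConstCLM F)))
    s (ContinuousLinearMap.hasFDerivAt _) (hasDerivAt_shiftKernel h θ s)

lemma continuous_smulConst_shiftKernel (φ : C(ℝ, ℝ)) (θ : C(unitInterval, ℝ)) {w : ℝ → F}
    (hw : Continuous w) : Continuous fun s => smulConstCLM F (shiftKernel φ θ s) (w s) :=
  ((smulConstCLM F).continuous.comp (continuous_shiftKernel φ θ)).clm_apply hw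

variable [CompleteSpace F]

lemma integral_mollify (ℓ : C(unitInterval, F) →L[ℝ] ℝ) (φ : C(ℝ, ℝ)) (θ : C(unitInterval, ℝ))
    {w : ℝ → F} (hw : Continuous w) :
    ∫ s in (0:ℝ)..1, mollify ℓ φ θ s (w s) =
      ℓ (∫ s in (0:ℝ)..1, smulConstCLM F (shiftKernel φ θ s) (w s)) :=
  ContinuousLinearMap.intervalIntegral_comp_comm ℓ
    ((continuous_smulConst_shiftKernel φ θ hw).intervalIntegrable _ _)

lemma integral_smulConst_apply (φ : C(ℝ, ℝ)) (θ : C(unitInterval, ℝ))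
    {w : ℝ → F} (hw : Continuous w) (t : unitInterval) :
    (∫ s in (0:ℝ)..1, smulConstCLM F (shiftKernel φ θ s) (w s)) t =
      ∫ s in (0:ℝ)..1, φ (s - θ t) • w s :=
  (ContinuousLinearMap.intervalIntegral_comp_comm (ContinuousMap.evalCLM ℝ t)
    ((continuous_smulConst_shiftKernel φ θ hw).intervalIntegrable (μ := volume) 0 1)).symm

/-- A mollifier supported in `(-δ, δ)`. -/
structure IsMollifier (φ : C(ℝ, ℝ)) (δ : ℝ) : Prop where
  pos : 0 < δ
  nonneg : ∀ s, 0 ≤ φ s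
  support : Function.support φ ⊆ Set.Ioo (-δ) δ
  integral : ∫ s, φ s = 1

lemma IsMollifier.integrable {φ : C(ℝ, ℝ)} {δ : ℝ} (h : IsMollifier φ δ) : Integrable φ := by
  by_contra hc
  exact zero_ne_one ((integral_undef hc).symm.trans h.integral)

lemma IsMollifier.intervalIntegral {φ : C(ℝ, ℝ)} {δ : ℝ} (h : IsMollifier φ δ) :
    ∫ s in (-δ)..δ, φ s = 1 := by
  rw [intervalIntegral.integral_eq_integral_of_support_subset
    (h.support.trans Set.Ioo_subset_Ioc_self), h.integral]

lemma abs_integral_mollify_le (ℓ : C(unitInterval, F) →L[ℝ] ℝ) {φ : C(ℝ, ℝ)} {δ : ℝ}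
    (hφ : IsMollifier φ δ) (θ : C(unitInterval, ℝ)) {w : ℝ → F} (hw : Continuous w) {B : ℝ}
    (hB : ∀ s, ‖w s‖ ≤ B) :
    |∫ s in (0:ℝ)..1, mollify ℓ φ θ s (w s)| ≤ ‖ℓ‖ * B := by
  have hB0 : 0 ≤ B := (norm_nonneg _).trans (hB 0)
  rw [integral_mollify ℓ φ θ hw, ← Real.norm_eq_abs]
  refine (ℓ.le_opNorm _).trans (mul_le_mul_of_nonneg_left ?_ (norm_nonneg _))
  rw [ContinuousMap.norm_le _ hB0]
  intro t
  rw [integral_smulConst_apply φ θ hw]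
  have hint : Integrable fun s => φ (s - θ t) := hφ.integrable.comp_sub_right (θ t)
  calc ‖∫ s in (0:ℝ)..1, φ (s - θ t) • w s‖ ≤ ∫ s in (0:ℝ)..1, φ (s - θ t) * B := by
        refine intervalIntegral.norm_integral_le_of_norm_le zero_le_one ?_
          (Continuous.intervalIntegrable (by fun_prop) _ _)
        refine Filter.Eventually.of_forall fun s _ => ?_
        rw [norm_smul, Real.norm_of_nonneg (hφ.nonneg _)]
        exact mul_le_mul_of_nonneg_left (hB s) (hφ.nonneg _)
    _ = (∫ s in (0:ℝ)..1, φ (s - θ t)) * B := by rw [intervalIntegral.integral_mul_const]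
    _ ≤ (∫ s, φ (s - θ t)) * B := by
        gcongr
        rw [intervalIntegral.integral_of_le zero_le_one]
        exact setIntegral_le_integral hint (Filter.Eventually.of_forall fun s => hφ.nonneg _)
    _ = B := by rw [integral_sub_right_eq_self (fun s => φ s), hφ.integral, one_mul]

/-- Averaging a functional over translations is pairing with its mollification. -/
lemma integral_translate_eq_integral_mollify (ℓ : C(unitInterval, F) →L[ℝ] ℝ) {φ : C(ℝ, ℝ)} {δ : ℝ}
    (hφ : IsMollifier φ δ) (θ : C(unitInterval, ℝ)) {w : ℝ → F} (hw : Continuous w)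
    (hsupp : Function.support w ⊆ Set.Ioc 0 1) (g : ℝ → C(unitInterval, F))
    (hg : ∀ u t, g u t = w (θ t + u)) (hgc : Continuous g) :
    ∫ u in (-δ)..δ, φ u * ℓ (g u) = ∫ s in (0:ℝ)..1, mollify ℓ φ θ s (w s) := by
  have hc : Continuous fun u => φ u • g u := by fun_prop
  rw [integral_mollify ℓ φ θ hw]
  have e : ∫ u in (-δ)..δ, φ u * ℓ (g u) = ℓ (∫ u in (-δ)..δ, φ u • g u) := by
    rw [← ContinuousLinearMap.intervalIntegral_comp_comm ℓ (hc.intervalIntegrable _ _)]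
    simp
  rw [e]
  congr 1
  ext t
  rw [integral_smulConst_apply φ θ hw]
  have e2 := ContinuousLinearMap.intervalIntegral_comp_comm (ContinuousMap.evalCLM ℝ t)
    (hc.intervalIntegrable (μ := volume) (-δ) δ)
  simp only [ContinuousMap.evalCLM_apply, ContinuousMap.smul_apply, hg] at e2
  rw [← e2]
  rw [intervalIntegral.integral_eq_integral_of_support_subset,
    intervalIntegral.integral_eq_integral_of_support_subset,
    ← integral_sub_right_eq_self (fun u => φ u • w (θ t + u)) (θ t)]
  · simp
  · exact (Function.support_smul_subset_right _ _).trans hsupp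
  · exact (Function.support_smul_subset_left _ _).trans
      (hφ.support.trans Set.Ioo_subset_Ioc_self)

lemma exists_mollifier {δ : ℝ} (hδ : 0 < δ) : ∃ φ φ' : C(ℝ, ℝ), IsMollifier φ δ ∧
    ∀ s, HasDerivAt φ (φ' s) s := by
  let f : ContDiffBump (0:ℝ) := ⟨δ / 2, δ, by positivity, by linarith⟩
  have hf : ContDiff ℝ 1 (f.normed volume) := f.contDiff_normed
  refine ⟨⟨f.normed volume, hf.continuous⟩, ⟨deriv (f.normed volume), hf.continuous_deriv le_rfl⟩,
    ⟨hδ, f.nonneg_normed, ?_, f.integral_normed⟩, fun s => ?_⟩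
  · simp only [ContinuousMap.coe_mk]
    rw [f.support_normed_eq, Real.ball_eq_Ioo]
    simp [f]
  · exact (hf.differentiable one_ne_zero s).hasDerivAt

end Mollification

namespace TransportProblem

variable {F H : Type*} [NormedAddCommGroup F] [NormedSpace ℝ F] [FiniteDimensional ℝ F]
  [NormedAddCommGroup H] [NormedSpace ℝ H] [FiniteDimensional ℝ H] {T : TransportProblem F H}

/-- Curves that are constant, equal to `(x₀, v₀)`, resp. `(x₁, v₁)`, near and beyond the
endpoints of `[0,1]`. -/
structure FlatEnds (x : ℝ → F) (v : ℝ → H) (x₀ x₁ : F) (v₀ v₁ : H) (η : ℝ) : Prop where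
  pos : 0 < η
  lt : η < 1 / 4
  left : ∀ s ≤ η, x s = x₀ ∧ v s = v₀
  right : ∀ s, 1 - η ≤ s → x s = x₁ ∧ v s = v₁

lemma FlatEnds.deriv_left {x : ℝ → F} {v : ℝ → H} {x₀ x₁ : F} {v₀ v₁ : H} {η : ℝ}
    (h : FlatEnds x v x₀ x₁ v₀ v₁ η) {s : ℝ} (hs : s ≤ 0) : deriv x s = 0 := by
  have : x =ᶠ[nhds s] fun _ => x₀ := by
    filter_upwards [Iio_mem_nhds (hs.trans_lt h.pos)] with r hr
    exact (h.left r (le_of_lt hr)).1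
  rw [this.deriv_eq, deriv_const]

lemma FlatEnds.deriv_right {x : ℝ → F} {v : ℝ → H} {x₀ x₁ : F} {v₀ v₁ : H} {η : ℝ}
    (h : FlatEnds x v x₀ x₁ v₀ v₁ η) {s : ℝ} (hs : 1 ≤ s) : deriv x s = 0 := by
  have : x =ᶠ[nhds s] fun _ => x₁ := by
    filter_upwards [Ioi_mem_nhds (show 1 - η < s by linarith [h.pos])] with r hr
    exact (h.right r (le_of_lt hr)).1
  rw [this.deriv_eq, deriv_const]

/-- The action of the time-rescaled, translated curve. -/
lemma Admissible.action_rescale_le {x : ℝ → F} {v : ℝ → H} (h : T.Admissible x v)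
    {x₀ x₁ : F} {v₀ v₁ : H} {η : ℝ} (hf : FlatEnds x v x₀ x₁ v₀ v₁ η) {δ u C : ℝ} (hδ : 0 < δ)
    (hu : u ∈ Set.Icc (-δ) δ) (h0 : T.q x₀ v₀ ≤ C) (h1 : T.q x₁ v₁ ≤ C) :
    ∫ t in (0:ℝ)..1, T.q (x ((1 + 2 * δ) * t - δ + u)) ((1 + 2 * δ) • v ((1 + 2 * δ) * t - δ + u))
      ≤ (1 + 2 * δ) * ((∫ s in (0:ℝ)..1, T.q (x s) (v s)) + 4 * δ * C) := by
  set c := 1 + 2 * δ with hc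
  have hcpos : 0 < c := by positivity
  have hQ : Continuous fun s => T.q (x s) (v s) :=
    continuous_q_comp h.contDiff.continuous h.continuous h.mem
  have hQi := fun a b => hQ.intervalIntegrable (μ := volume) a b
  have hQ0 : ∀ s, 0 ≤ T.q (x s) (v s) := fun s => q_nonneg (h.mem s) _
  have e1 : ∀ t, T.q (x (c * t - δ + u)) (c • v (c * t - δ + u)) =
      c ^ 2 * T.q (x (c * t + (u - δ))) (v (c * t + (u - δ))) := by
    intro t
    rw [T.homogeneous _ (h.mem _), show c * t - δ + u = c * t + (u - δ) by ring]
  simp_rw [e1]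
  rw [intervalIntegral.integral_const_mul,
    intervalIntegral.integral_comp_mul_add (fun s => T.q (x s) (v s)) hcpos.ne']
  have e2 : ∫ s in (c * 0 + (u - δ))..(c * 1 + (u - δ)), T.q (x s) (v s) ≤
      ∫ s in (-2 * δ)..(1 + 2 * δ), T.q (x s) (v s) := by
    apply intervalIntegral.integral_mono_interval
    · linarith [hu.1]
    · nlinarith
    · linarith [hu.2]
    · exact Filter.Eventually.of_forall hQ0
    · exact hQi _ _
  have e3 : ∫ s in (-2 * δ)..0, T.q (x s) (v s) ≤ 2 * δ * C := by
    calc ∫ s in (-2 * δ)..0, T.q (x s) (v s) ≤ ∫ s in (-2 * δ)..0, C := by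
          apply intervalIntegral.integral_mono_on (by linarith) (hQi _ _)
            (continuous_const.intervalIntegrable _ _)
          intro s hs
          obtain ⟨a, b⟩ := hf.left s (hs.2.trans hf.pos.le)
          rw [a, b]; exact h0
      _ = 2 * δ * C := by simp
  have e4 : ∫ s in (1:ℝ)..(1 + 2 * δ), T.q (x s) (v s) ≤ 2 * δ * C := by
    calc ∫ s in (1:ℝ)..(1 + 2 * δ), T.q (x s) (v s) ≤ ∫ s in (1:ℝ)..(1 + 2 * δ), C := by
          apply intervalIntegral.integral_mono_on (by linarith) (hQi _ _)
            (continuous_const.intervalIntegrable _ _)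
          intro s hs
          obtain ⟨a, b⟩ := hf.right s (by linarith [hs.1, hf.pos])
          rw [a, b]; exact h1
      _ = 2 * δ * C := by simp
  have e5 : ∫ s in (-2 * δ)..(1 + 2 * δ), T.q (x s) (v s) ≤
      (∫ s in (0:ℝ)..1, T.q (x s) (v s)) + 4 * δ * C := by
    rw [← intervalIntegral.integral_add_adjacent_intervals (hQi _ 0) (hQi _ _),
      ← intervalIntegral.integral_add_adjacent_intervals (hQi 0 1) (hQi _ _)]
    linarith
  have e6 : c ^ 2 * c⁻¹ = c := by field_simp
  rw [smul_eq_mul, ← mul_assoc, e6]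
  exact mul_le_mul_of_nonneg_left (e2.trans e5) hcpos.le

variable (T) in
lemma exists_bound_drift : ∃ B, 0 ≤ B ∧ ∀ x ∈ T.Ω, ‖T.Λ x + T.b‖ ≤ B := by
  obtain ⟨R, hR⟩ := T.isBounded.exists_norm_le
  refine ⟨‖T.Λ‖ * |R| + ‖T.b‖, by positivity, fun x hx => ?_⟩
  refine (norm_add_le _ _).trans (add_le_add_left ((T.Λ.le_opNorm x).trans ?_) _)
  exact mul_le_mul_of_nonneg_left ((hR x hx).trans (le_abs_self R)) (norm_nonneg _)

/-- A `C¹` curve of functionals that is, up to `κ`, a multiplier for the continuity equation. -/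
lemma IsLowerBound.exists_multiplier {x₀ x₁ : F} {P : ℝ} (hP : T.IsLowerBound x₀ x₁ P)
    (h₀ : x₀ ∈ T.Ω) (h₁ : x₁ ∈ T.Ω) {κ : ℝ} (hκ : 0 < κ) :
    ∃ (A A' : ℝ → F →L[ℝ] ℝ) (v₀ v₁ : H), (∀ s, HasDerivAt A (A' s) s) ∧ Continuous A' ∧
      ∀ x v η, T.Admissible x v → FlatEnds x v x₀ x₁ v₀ v₁ η →
        P - κ ≤ (∫ s in (0:ℝ)..1, T.q (x s) (v s)) +
          ∫ s in (0:ℝ)..1, A s (T.defect x v s) := by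
  obtain ⟨ℓ, hℓ⟩ := hP.exists_functional h₀ h₁
  obtain ⟨R, hR⟩ := T.exists_rightInverse
  obtain ⟨B, hB0, hB⟩ := T.exists_bound_drift
  set w₀ := R (T.Λ x₀ + T.b) with hw₀
  set w₁ := R (T.Λ x₁ + T.b) with hw₁
  set C := T.q x₀ w₀ + T.q x₁ w₁ with hC
  have hq0 := T.q_nonneg h₀ w₀
  have hq1 := T.q_nonneg h₁ w₁
  have hCnn : 0 ≤ C := add_nonneg hq0 hq1
  set K := 2 * |P| + 2 * (‖ℓ‖ * B) + 4 * C + 1 with hK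
  have hKpos : 0 < K := by positivity
  set δ := κ / K with hδdef
  have hδ : 0 < δ := by positivity
  have hδK : δ * K = κ := div_mul_cancel₀ _ hKpos.ne'
  obtain ⟨φ, φ', hφ, hφ'⟩ := exists_mollifier hδ
  set c := 1 + 2 * δ with hc
  have hcpos : 0 < c := by positivity
  have hc1 : 1 ≤ c := by linarith
  let θ : C(unitInterval, ℝ) := ⟨fun t => c * t - δ, by fun_prop⟩
  refine ⟨fun s => -mollify ℓ φ θ s, fun s => -mollify ℓ φ' θ s, c⁻¹ • w₀, c⁻¹ • w₁,
    fun s => (hasDerivAt_mollify ℓ hφ' θ s).neg, (continuous_mollify ℓ φ' θ).neg, ?_⟩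
  intro x v η hxv hf
  have hx := hxv.contDiff.continuous
  have hx' := hxv.contDiff.continuous_deriv le_rfl
  have hv := hxv.continuous
  have hdef := hxv.continuous_defect
  set Q := ∫ s in (0:ℝ)..1, T.q (x s) (v s) with hQ
  let w : ℝ → F := fun s => c • deriv x s + c • T.D (v s) - (T.Λ (x s) + T.b)
  have hw : Continuous w := by fun_prop
  have hend : ∀ y : F, c • T.D (c⁻¹ • R y) = y := by
    intro y
    rw [map_smul, hR, smul_smul, mul_inv_cancel₀ hcpos.ne', one_smul]
  have hsupp : Function.support w ⊆ Set.Ioc 0 1 := by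
    intro s hs
    by_contra hcon
    rw [Set.mem_Ioc, not_and_or, not_lt, not_le] at hcon
    apply hs
    rcases hcon with h | h
    · obtain ⟨a, b⟩ := hf.left s (h.trans hf.pos.le)
      simp only [w, hf.deriv_left h, a, b, hw₀, hend]
      simp
    · obtain ⟨a, b⟩ := hf.right s (by linarith [hf.pos])
      simp only [w, hf.deriv_right h.le, a, b, hw₁, hend]
      simp
  let g : ℝ → C(unitInterval, F) := fun u => ⟨fun t => w (θ t + u), by fun_prop⟩
  have hgc : Continuous g := by
    apply ContinuousMap.continuous_of_continuous_uncurry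
    simp only [g, ContinuousMap.coe_mk, Function.uncurry_def]
    fun_prop
  have htrans := integral_translate_eq_integral_mollify ℓ hφ θ hw hsupp g (fun _ _ => rfl) hgc
  have hqC0 : T.q x₀ (c⁻¹ • w₀) ≤ C := by
    rw [T.homogeneous _ h₀]
    have : c⁻¹ ^ 2 ≤ 1 := pow_le_one₀ (by positivity) (inv_le_one_of_one_le₀ hc1)
    nlinarith
  have hqC1 : T.q x₁ (c⁻¹ • w₁) ≤ C := by
    rw [T.homogeneous _ h₁]
    have : c⁻¹ ^ 2 ≤ 1 := pow_le_one₀ (by positivity) (inv_le_one_of_one_le₀ hc1)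
    nlinarith
  have hpoint : ∀ u ∈ Set.Icc (-δ) δ, P + ℓ (g u) ≤ c * (Q + 4 * δ * C) := by
    intro u hu
    refine le_trans ?_ (hxv.action_rescale_le hf hδ hu hqC0 hqC1)
    have hd : ∀ t, HasDerivAt (fun t => x (c * t - δ + u)) (c • deriv x (c * t - δ + u)) t := by
      intro t
      have h1 := ((hxv.contDiff.differentiable one_ne_zero) (c * t - δ + u)).hasDerivAt
      have h2 : HasDerivAt (fun t : ℝ => c * t - δ + u) c t := by
        simpa using (((hasDerivAt_id t).const_mul c).sub_const δ).add_const u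
      exact h1.scomp t h2
    refine hℓ (fun t => x (c * t - δ + u)) (fun t => c • v (c * t - δ + u))
      ⟨?_, by fun_prop, fun t => hxv.mem _⟩ ?_ ?_ (g u) ?_
    · exact hxv.contDiff.comp (by fun_prop)
    · exact (hf.left _ (by linarith [hu.2, hf.pos])).1
    · exact (hf.right _ (by linarith [hu.1, hf.pos])).1
    · intro t
      simp only [defect, (hd t).deriv, g, w, θ, ContinuousMap.coe_mk, map_smul]
  have hint : P + ∫ s in (0:ℝ)..1, mollify ℓ φ θ s (w s) ≤ c * (Q + 4 * δ * C) := by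
    have h1 : ∫ u in (-δ)..δ, φ u * (P + ℓ (g u)) ≤
        ∫ u in (-δ)..δ, φ u * (c * (Q + 4 * δ * C)) := by
      apply intervalIntegral.integral_mono_on (by linarith)
        (Continuous.intervalIntegrable (by fun_prop) _ _)
        (Continuous.intervalIntegrable (by fun_prop) _ _)
      intro u hu
      exact mul_le_mul_of_nonneg_left (hpoint u hu) (hφ.nonneg u)
    rw [intervalIntegral.integral_mul_const, hφ.intervalIntegral, one_mul] at h1
    simp_rw [mul_add] at h1
    rw [intervalIntegral.integral_add (Continuous.intervalIntegrable (by fun_prop) _ _)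
        (Continuous.intervalIntegrable (by fun_prop) _ _), intervalIntegral.integral_mul_const,
      hφ.intervalIntegral, one_mul, htrans] at h1
    linarith
  have hA := continuous_mollify ℓ φ θ
  have hsplit : ∫ s in (0:ℝ)..1, mollify ℓ φ θ s (w s) =
      c * (∫ s in (0:ℝ)..1, mollify ℓ φ θ s (T.defect x v s)) +
        2 * δ * ∫ s in (0:ℝ)..1, mollify ℓ φ θ s (T.Λ (x s) + T.b) := by
    rw [← intervalIntegral.integral_const_mul, ← intervalIntegral.integral_const_mul,
      ← intervalIntegral.integral_add (Continuous.intervalIntegrable (by fun_prop) _ _)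
        (Continuous.intervalIntegrable (by fun_prop) _ _)]
    congr 1
    ext s
    have : w s = c • T.defect x v s + (2 * δ) • (T.Λ (x s) + T.b) := by
      simp only [w, defect, hc]
      module
    rw [this, map_add, map_smul, map_smul, smul_eq_mul, smul_eq_mul]
  have hbd := (abs_le.1 (abs_integral_mollify_le ℓ hφ θ
    (w := fun s => T.Λ (x s) + T.b) (by fun_prop) fun s => hB _ (hxv.mem s))).1
  simp only [_root_.neg_apply, intervalIntegral.integral_neg]
  set I₁ := ∫ s in (0:ℝ)..1, mollify ℓ φ θ s (T.defect x v s)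
  set I₂ := ∫ s in (0:ℝ)..1, mollify ℓ φ θ s (T.Λ (x s) + T.b)
  rw [hsplit] at hint
  have hfin : c * (P - κ) ≤ c * (Q + -I₁) := by
    have e1 : 2 * δ * -(‖ℓ‖ * B) ≤ 2 * δ * I₂ := mul_le_mul_of_nonneg_left hbd (by positivity)
    have e2 : c * κ = κ + 2 * δ * κ := by rw [hc]; ring
    have e3 : κ = δ * (2 * |P|) + δ * (2 * (‖ℓ‖ * B)) + δ * (4 * C) + δ := by
      rw [← hδK, hK]; ring
    have e4 : 2 * δ * P ≤ 2 * δ * |P| := mul_le_mul_of_nonneg_left (le_abs_self P) (by positivity)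
    have e5 : c * (4 * δ * C) = 4 * δ * C + 2 * δ * (4 * δ * C) := by rw [hc]; ring
    have e6 : 2 * δ * (4 * δ * C) ≤ 2 * δ * κ := by
      apply mul_le_mul_of_nonneg_left _ (by positivity)
      rw [e3]
      have : 0 ≤ δ * (2 * |P|) := by positivity
      have : 0 ≤ δ * (2 * (‖ℓ‖ * B)) := by positivity
      linarith
    have e7 : c * P = P + 2 * δ * P := by rw [hc]; ring
    rw [mul_sub, e7, e2]
    rw [mul_add, e5] at hint
    rw [mul_add, mul_neg]
    linarith
  exact le_of_mul_le_mul_left hfin hcpos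

end TransportProblem

namespace TransportProblem

variable {F H : Type*} [NormedAddCommGroup F] [NormedSpace ℝ F] [FiniteDimensional ℝ F]
  [NormedAddCommGroup H] [NormedSpace ℝ H] [FiniteDimensional ℝ H] {T : TransportProblem F H}

variable (T) in
/-- The Legendre transform of the Lagrangian in both variables. -/
noncomputable def conjugate (γ : (F →L[ℝ] ℝ) × (H →L[ℝ] ℝ)) : ℝ :=
  ⨆ p : T.Ω × H, (γ.1 p.1 + γ.2 p.2 - T.q p.1 p.2)

lemma bddAbove_conjugate (γ : (F →L[ℝ] ℝ) × (H →L[ℝ] ℝ)) :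
    BddAbove (Set.range fun p : T.Ω × H => γ.1 p.1 + γ.2 p.2 - T.q p.1 p.2) := by
  obtain ⟨R, hR⟩ := T.isBounded.exists_norm_le
  refine ⟨‖γ.1‖ * R + ‖γ.2‖ ^ 2 / (4 * T.c), ?_⟩
  rintro _ ⟨⟨⟨x, hx⟩, v⟩, rfl⟩
  have h1 : γ.1 x ≤ ‖γ.1‖ * R := (le_abs_self _).trans <| (γ.1.le_opNorm x).trans <|
    mul_le_mul_of_nonneg_left (hR x hx) (norm_nonneg _)
  have h2 : γ.2 v ≤ ‖γ.2‖ * ‖v‖ := (le_abs_self _).trans (γ.2.le_opNorm v)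
  have h3 := T.coercive x hx v
  have h4 : ‖γ.2‖ * ‖v‖ - T.c * ‖v‖ ^ 2 ≤ ‖γ.2‖ ^ 2 / (4 * T.c) := by
    rw [le_div_iff₀ (by linarith [T.c_pos])]
    nlinarith [sq_nonneg (‖γ.2‖ - 2 * T.c * ‖v‖)]
  dsimp only
  linarith

lemma le_conjugate (γ : (F →L[ℝ] ℝ) × (H →L[ℝ] ℝ)) {x : F} (hx : x ∈ T.Ω) (v : H) :
    γ.1 x + γ.2 v - T.q x v ≤ T.conjugate γ :=
  le_ciSup (T.bddAbove_conjugate γ) (⟨x, hx⟩, v)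

lemma continuous_conjugate (hne : T.Ω.Nonempty) : Continuous T.conjugate := by
  have : Nonempty T.Ω := hne.to_subtype
  have hconv : ConvexOn ℝ Set.univ T.conjugate := by
    refine ⟨convex_univ, fun γ _ δ _ a b ha hb hab => ?_⟩
    refine ciSup_le fun ⟨⟨x, hx⟩, v⟩ => ?_
    have h1 := mul_le_mul_of_nonneg_left (T.le_conjugate γ hx v) ha
    have h2 := mul_le_mul_of_nonneg_left (T.le_conjugate δ hx v) hb
    have h3 : T.q x v = a * T.q x v + b * T.q x v := by rw [← add_mul, hab, one_mul]
    simp only [Prod.fst_add, Prod.smul_fst, Prod.snd_add, Prod.smul_snd, _root_.add_apply,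
      _root_.smul_apply, smul_eq_mul]
    rw [h3]
    linarith
  exact continuousOn_univ.1 (hconv.continuousOn isOpen_univ)

variable (T) in
/-- The dual integrand of the multiplier `A` at time `s`. -/
noncomputable def dualIntegrand (A A' : ℝ → F →L[ℝ] ℝ) (s : ℝ) (p : F × H) : ℝ :=
  A' s p.1 + A s (T.Λ p.1 + T.b) - A s (T.D p.2) - T.q p.1 p.2

lemma concaveOn_dualIntegrand (A A' : ℝ → F →L[ℝ] ℝ) (s : ℝ) :
    ConcaveOn ℝ (T.Ω ×ˢ Set.univ) (T.dualIntegrand A A' s) := by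
  refine ⟨T.convexOn.1, fun p hp r hr a b ha hb hab => ?_⟩
  have h := T.convexOn.2 hp hr ha hb hab
  have hb' : A s T.b = a * A s T.b + b * A s T.b := by rw [← add_mul, hab, one_mul]
  simp only [dualIntegrand, Prod.fst_add, Prod.smul_fst, Prod.snd_add, Prod.smul_snd, map_add,
    map_smul, smul_eq_mul] at h ⊢
  linarith

lemma Admissible.action_add_multiplier {x : ℝ → F} {v : ℝ → H} (h : T.Admissible x v)
    {A A' : ℝ → F →L[ℝ] ℝ} (hA : ∀ s, HasDerivAt A (A' s) s) (hA' : Continuous A') :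
    (∫ s in (0:ℝ)..1, T.q (x s) (v s)) + ∫ s in (0:ℝ)..1, A s (T.defect x v s) =
      A 1 (x 1) - A 0 (x 0) - ∫ s in (0:ℝ)..1, T.dualIntegrand A A' s (x s, v s) := by
  have hAc : Continuous A := continuous_iff_continuousAt.2 fun s => (hA s).continuousAt
  have hx := h.contDiff.continuous
  have hx' := h.contDiff.continuous_deriv le_rfl
  have hv := h.continuous
  have hq : Continuous fun s => T.q (x s) (v s) := continuous_q_comp hx hv h.mem
  have hdef := h.continuous_defect
  have hd : ∀ s, HasDerivAt (fun s => A s (x s)) (A' s (x s) + A s (deriv x s)) s := fun s =>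
    (hA s).clm_apply ((h.contDiff.differentiable one_ne_zero) s).hasDerivAt
  have hbp := intervalIntegral.integral_eq_sub_of_hasDerivAt (a := 0) (b := 1)
    (fun s _ => hd s) (Continuous.intervalIntegrable (by fun_prop) _ _)
  have hg : Continuous fun s => T.dualIntegrand A A' s (x s, v s) := by
    unfold dualIntegrand
    fun_prop
  rw [← hbp, eq_sub_iff_add_eq,
    ← intervalIntegral.integral_add (hq.intervalIntegrable _ _)
      (Continuous.intervalIntegrable (by fun_prop) _ _),
    ← intervalIntegral.integral_add (Continuous.intervalIntegrable (by fun_prop) _ _)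
      (hg.intervalIntegrable _ _)]
  congr 1
  ext s
  simp only [dualIntegrand, defect, map_add, map_sub]
  ring

/-- Near-optimal selection: a smooth curve, constant near the ends, along which the dual
integrand almost attains its supremum `m`. -/
lemma exists_near_optimal {A A' : ℝ → F →L[ℝ] ℝ} (hA : Continuous A) (hA' : Continuous A')
    {m : ℝ → ℝ} (hm : Continuous m)
    (hopt : ∀ s, ∀ r > 0, ∃ p : F × H, p.1 ∈ T.Ω ∧ m s - r < T.dualIntegrand A A' s p)
    {x₀ x₁ : F} {v₀ v₁ : H} (h₀ : x₀ ∈ T.Ω) (h₁ : x₁ ∈ T.Ω) {C κ η : ℝ} (hκ : 0 < κ) (hκC : κ ≤ C)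
    (hη : 0 < η) (hη' : η < 1 / 8)
    (hC₀ : ∀ s ∈ Set.Icc (0:ℝ) 1, m s - C < T.dualIntegrand A A' s (x₀, v₀))
    (hC₁ : ∀ s ∈ Set.Icc (0:ℝ) 1, m s - C < T.dualIntegrand A A' s (x₁, v₁)) :
    ∃ x v, T.Admissible x v ∧ FlatEnds x v x₀ x₁ v₀ v₁ η ∧
      (∀ s ∈ Set.Icc (0:ℝ) 1, m s - C < T.dualIntegrand A A' s (x s, v s)) ∧
      ∀ s ∈ Set.Icc (2 * η) (1 - 2 * η), m s - κ < T.dualIntegrand A A' s (x s, v s) := by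
  let t : ℝ → Set (F × H) := fun s => {p | p.1 ∈ T.Ω ∧ (s ≤ η → p = (x₀, v₀)) ∧
    (1 - η ≤ s → p = (x₁, v₁)) ∧ (s ∈ Set.Icc (0:ℝ) 1 → m s - C < T.dualIntegrand A A' s p) ∧
    (s ∈ Set.Icc (2 * η) (1 - 2 * η) → m s - κ < T.dualIntegrand A A' s p)}
  have ht : ∀ s, Convex ℝ (t s) := by
    intro s p hp r hr a b ha hb hab
    have hgt := fun c => (T.concaveOn_dualIntegrand A A' s).convex_gt c
    have hΩ := T.convex_Ω hp.1 hr.1 ha hb hab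
    refine ⟨hΩ, fun h => ?_, fun h => ?_, fun h => ?_, fun h => ?_⟩
    · rw [hp.2.1 h, hr.2.1 h, ← add_smul, hab, one_smul]
    · rw [hp.2.2.1 h, hr.2.2.1 h, ← add_smul, hab, one_smul]
    · exact (hgt _ ⟨⟨hp.1, trivial⟩, hp.2.2.2.1 h⟩ ⟨⟨hr.1, trivial⟩, hr.2.2.2.1 h⟩ ha hb hab).2
    · exact (hgt _ ⟨⟨hp.1, trivial⟩, hp.2.2.2.2 h⟩ ⟨⟨hr.1, trivial⟩, hr.2.2.2.2 h⟩ ha hb hab).2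
  have hloc : ∀ s, ∃ p, ∀ᶠ y in nhds s, p ∈ t y := by
    intro s
    rcases lt_or_ge s (2 * η) with h | h
    · refine ⟨(x₀, v₀), ?_⟩
      filter_upwards [Iio_mem_nhds h] with y hy
      rw [Set.mem_Iio] at hy
      exact ⟨h₀, fun _ => rfl, fun h => by linarith, fun h => hC₀ y h, fun h => by
        linarith [h.1]⟩
    rcases lt_or_ge (1 - 2 * η) s with h' | h'
    · refine ⟨(x₁, v₁), ?_⟩
      filter_upwards [Ioi_mem_nhds h'] with y hy
      rw [Set.mem_Ioi] at hy
      exact ⟨h₁, fun h => by linarith, fun _ => rfl, fun h => hC₁ y h, fun h => by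
        linarith [h.2]⟩
    · obtain ⟨p, hp, hps⟩ := hopt s κ hκ
      refine ⟨p, ?_⟩
      have hc : Continuous fun y => T.dualIntegrand A A' y p := by
        unfold dualIntegrand
        fun_prop
      have hev : ∀ᶠ y in nhds s, m y - κ < T.dualIntegrand A A' y p :=
        (hm.sub continuous_const).continuousAt.eventually_lt hc.continuousAt hps
      filter_upwards [hev, Ioi_mem_nhds (show η < s by linarith),
        Iio_mem_nhds (show s < 1 - η by linarith)] with y hy hy1 hy2
      rw [Set.mem_Iio] at hy2
      rw [Set.mem_Ioi] at hy1
      exact ⟨hp, fun h => by linarith, fun h => by linarith, fun _ => by linarith, fun _ => hy⟩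
  obtain ⟨g, hg⟩ := exists_contMDiffMap_forall_mem_convex_of_local_const (n := 1)
    (modelWithCornersSelf ℝ ℝ) ht hloc
  have hgc : ContDiff ℝ 1 g := g.contMDiff.contDiff
  refine ⟨fun s => (g s).1, fun s => (g s).2, ⟨hgc.fst, hgc.continuous.snd, fun s => (hg s).1⟩,
    ⟨hη, by linarith, fun s hs => ?_, fun s hs => ?_⟩, fun s hs => (hg s).2.2.2.1 hs,
    fun s hs => (hg s).2.2.2.2 hs⟩
  · rw [(hg s).2.1 hs]; exact ⟨rfl, rfl⟩
  · rw [(hg s).2.2.1 hs]; exact ⟨rfl, rfl⟩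

/-- **Abstract duality.** A lower bound for the transport problem is attained, up to `κ`, by an
affine subsolution of the dual Hamilton–Jacobi inequality. -/
theorem IsLowerBound.exists_subsolution {x₀ x₁ : F} {P : ℝ} (hP : T.IsLowerBound x₀ x₁ P)
    (h₀ : x₀ ∈ T.Ω) (h₁ : x₁ ∈ T.Ω) {κ : ℝ} (hκ : 0 < κ) :
    ∃ (A A' : ℝ → F →L[ℝ] ℝ) (a a' : ℝ → ℝ), (∀ s, HasDerivAt A (A' s) s) ∧
      (∀ s, HasDerivAt a (a' s) s) ∧ Continuous A' ∧ Continuous a' ∧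
      (∀ s, ∀ x ∈ T.Ω, ∀ v,
        A' s x + a' s + A s (T.Λ x + T.b) - A s (T.D v) - T.q x v ≤ 0) ∧
      P - κ ≤ A 1 x₁ + a 1 - (A 0 x₀ + a 0) := by
  obtain ⟨A, A', v₀, v₁, hA, hA', hmul⟩ := hP.exists_multiplier h₀ h₁ (κ := κ / 3) (by positivity)
  have hAc : Continuous A := continuous_iff_continuousAt.2 fun s => (hA s).continuousAt
  have : Nonempty T.Ω := ⟨⟨x₀, h₀⟩⟩
  let γ : ℝ → (F →L[ℝ] ℝ) × (H →L[ℝ] ℝ) := fun s => (A' s + (A s).comp T.Λ, -(A s).comp T.D)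
  let m : ℝ → ℝ := fun s => T.conjugate (γ s) + A s T.b
  have hγ : Continuous γ := by fun_prop
  have hm : Continuous m := ((continuous_conjugate ⟨x₀, h₀⟩).comp hγ).add
    (hAc.clm_apply continuous_const)
  have hγg : ∀ s p, (γ s).1 p.1 + (γ s).2 p.2 - T.q p.1 p.2 + A s T.b =
      T.dualIntegrand A A' s p := by
    intro s p
    simp only [γ, dualIntegrand, _root_.add_apply, _root_.neg_apply, map_add,
      ContinuousLinearMap.comp_apply]
    ring
  have hle : ∀ s, ∀ x ∈ T.Ω, ∀ v, T.dualIntegrand A A' s (x, v) ≤ m s := by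
    intro s x hx v
    rw [← hγg]
    exact add_le_add_left (T.le_conjugate (γ s) hx v) _
  have hopt : ∀ s, ∀ r > 0, ∃ p : F × H, p.1 ∈ T.Ω ∧ m s - r < T.dualIntegrand A A' s p := by
    intro s r hr
    obtain ⟨⟨⟨x, hx⟩, v⟩, hxv⟩ := exists_lt_of_lt_ciSup
      (show T.conjugate (γ s) - r < ⨆ p : T.Ω × H, ((γ s).1 p.1 + (γ s).2 p.2 - T.q p.1 p.2) from
        sub_lt_self _ hr)
    refine ⟨(x, v), hx, ?_⟩
    rw [← hγg]
    simp only [m]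
    dsimp only at hxv ⊢
    linarith
  have hbound : ∀ p : F × H, ∃ C, ∀ s ∈ Set.Icc (0:ℝ) 1, m s - T.dualIntegrand A A' s p ≤ C := by
    intro p
    have hc : Continuous fun s => m s - T.dualIntegrand A A' s p := by
      unfold dualIntegrand
      fun_prop
    obtain ⟨C, hC⟩ := (isCompact_Icc.image hc).bddAbove
    exact ⟨C, fun s hs => hC ⟨s, hs, rfl⟩⟩
  obtain ⟨C₀, hC₀⟩ := hbound (x₀, v₀)
  obtain ⟨C₁, hC₁⟩ := hbound (x₁, v₁)
  set C := |C₀| + |C₁| + κ + 1 with hC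
  have hCpos : 0 < C := by positivity
  set η := min (1 / 16) (κ / (12 * C)) with hη
  have hηpos : 0 < η := by positivity
  have hη8 : η < 1 / 8 := (min_le_left _ _).trans_lt (by norm_num)
  have hηC : 4 * η * C ≤ κ / 3 := by
    have : η * (12 * C) ≤ κ := (le_div_iff₀ (by positivity)).1 (min_le_right _ _)
    linarith
  obtain ⟨x, v, hxv, hf, hg1, hg2⟩ := exists_near_optimal hAc hA' hm hopt h₀ h₁
    (C := C) (κ := κ / 3) (η := η) (v₀ := v₀) (v₁ := v₁) (by positivity)
    (by linarith [abs_nonneg C₀, abs_nonneg C₁]) hηpos hη8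
    (fun s hs => by linarith [hC₀ s hs, le_abs_self C₀, abs_nonneg C₁])
    (fun s hs => by linarith [hC₁ s hs, le_abs_self C₁, abs_nonneg C₀])
  have hmain := hmul x v η hxv hf
  rw [hxv.action_add_multiplier hA hA', (hf.left 0 hηpos.le).1, (hf.right 1 (by linarith)).1]
    at hmain
  have hq : Continuous fun s => T.q (x s) (v s) :=
    continuous_q_comp hxv.contDiff.continuous hxv.continuous hxv.mem
  have hx := hxv.contDiff.continuous
  have hv := hxv.continuous
  have hgc : Continuous fun s => T.dualIntegrand A A' s (x s, v s) := by
    unfold dualIntegrand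
    fun_prop
  have hdiff : Continuous fun s => m s - T.dualIntegrand A A' s (x s, v s) := hm.sub hgc
  have hint : ∫ s in (0:ℝ)..1, (m s - T.dualIntegrand A A' s (x s, v s)) ≤ 2 * κ / 3 := by
    have hbd : ∀ u w c : ℝ, u ≤ w →
        (∀ s ∈ Set.Icc u w, m s - T.dualIntegrand A A' s (x s, v s) ≤ c) →
        ∫ s in u..w, (m s - T.dualIntegrand A A' s (x s, v s)) ≤ (w - u) * c := by
      intro u w c huw hs
      calc _ ≤ ∫ s in u..w, c := intervalIntegral.integral_mono_on huw
            (hdiff.intervalIntegrable _ _) (continuous_const.intervalIntegrable _ _) hs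
        _ = (w - u) * c := by simp
    have i1 := hbd 0 (2 * η) C (by linarith) fun s hs => by
      linarith [hg1 s ⟨hs.1, by linarith [hs.2]⟩]
    have i2 := hbd (2 * η) (1 - 2 * η) (κ / 3) (by linarith) fun s hs => by linarith [hg2 s hs]
    have i3 := hbd (1 - 2 * η) 1 C (by linarith) fun s hs => by
      linarith [hg1 s ⟨by linarith [hs.1], hs.2⟩]
    rw [← intervalIntegral.integral_add_adjacent_intervals (hdiff.intervalIntegrable 0 (2 * η))
        (hdiff.intervalIntegrable (2 * η) 1),
      ← intervalIntegral.integral_add_adjacent_intervals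
        (hdiff.intervalIntegrable (2 * η) (1 - 2 * η)) (hdiff.intervalIntegrable (1 - 2 * η) 1)]
    have : (1 - 2 * η - 2 * η) * (κ / 3) ≤ κ / 3 := by nlinarith
    linarith
  rw [intervalIntegral.integral_sub (hm.intervalIntegrable _ _) (hgc.intervalIntegrable _ _)] at hint
  refine ⟨A, A', fun s => -∫ r in (0:ℝ)..s, m r, fun s => -m s, hA, fun s => ?_, hA', hm.neg, ?_, ?_⟩
  · exact (intervalIntegral.integral_hasDerivAt_right (hm.intervalIntegrable _ _)
      (hm.stronglyMeasurableAtFilter _ _) hm.continuousAt).neg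
  · intro s x hx v
    have := hle s x hx v
    simp only [dualIntegrand] at this
    linarith
  · simp only [intervalIntegral.integral_same]
    linarith

end TransportProblem

section Spectral

variable {N : Type*} [Fintype N] [DecidableEq N]

lemma trace_conjTranspose_mul (A B : Matrix N N ℂ) :
    (Aᴴ * B).trace = ∑ i, ∑ j, star (A i j) * B i j := by
  simp only [Matrix.trace, Matrix.diag, Matrix.mul_apply, conjTranspose_apply]
  exact Finset.sum_comm

lemma gns_eq_sum (A B : Matrix N N ℂ) :
    gns A B = (∑ i, ∑ j, star (A i j) * B i j) / Fintype.card N := by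
  rw [gns, tau, trace_conjTranspose_mul]

lemma gns_self_re (A : Matrix N N ℂ) : (gns A A).re = (∑ a, ∑ b, ‖A a b‖ ^ 2) / Fintype.card N := by
  rw [gns_eq_sum, Complex.div_natCast_re, Complex.re_sum]
  congr 1
  refine Finset.sum_congr rfl fun a _ => ?_
  rw [Complex.re_sum]
  refine Finset.sum_congr rfl fun b _ => ?_
  rw [Complex.star_def, Complex.conj_mul']
  norm_cast

/-- `U` diagonalizes the hermitian matrix `X`, with eigenvalues `l`. -/
structure Diagonalizes (U : Matrix N N ℂ) (l : N → ℝ) (X : Matrix N N ℂ) : Prop where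
  left : Uᴴ * U = 1
  right : U * Uᴴ = 1
  eq : X = U * Matrix.diagonal (fun i => (l i : ℂ)) * Uᴴ

lemma Matrix.IsHermitian.diagonalizes {X : Matrix N N ℂ} (hX : X.IsHermitian) :
    Diagonalizes (hX.eigenvectorUnitary : Matrix N N ℂ) hX.eigenvalues X where
  left := Unitary.star_mul_self_of_mem hX.eigenvectorUnitary.2
  right := Unitary.mul_star_self_of_mem hX.eigenvectorUnitary.2
  eq := by simpa [Unitary.conjStarAlgAut_apply] using! hX.spectral_theorem

namespace Diagonalizes

variable {U X : Matrix N N ℂ} {l : N → ℝ}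

lemma isHermitian (h : Diagonalizes U l X) : X.IsHermitian := by
  rw [h.eq]
  simp [Matrix.IsHermitian, Matrix.mul_assoc, Matrix.diagonal_conjTranspose, Pi.star_def]

/-- The functional calculus does not depend on the diagonalization. -/
lemma mpow_eq (h : Diagonalizes U l X) (s : ℝ) :
    mpow X s = U * Matrix.diagonal (fun i => ((l i ^ s : ℝ) : ℂ)) * Uᴴ := by
  have hX := h.isHermitian
  rw [mpow, dif_pos hX]
  have h0 := hX.diagonalizes
  set U₀ : Matrix N N ℂ := (hX.eigenvectorUnitary : Matrix N N ℂ)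
  set l₀ := hX.eigenvalues
  change U₀ * _ * U₀ᴴ = _
  set W := Uᴴ * U₀ with hW
  have e1 : Matrix.diagonal (fun i => (l i : ℂ)) * W = W * Matrix.diagonal (fun i => (l₀ i : ℂ)) := by
    have : Uᴴ * X * U₀ = Uᴴ * X * U₀ := rfl
    conv_lhs at this => rw [h.eq]
    conv_rhs at this => rw [h0.eq]
    calc _ = (Uᴴ * U) * Matrix.diagonal (fun i => (l i : ℂ)) * (Uᴴ * U₀) := by
          rw [h.left, Matrix.one_mul]
      _ = Uᴴ * (U * Matrix.diagonal (fun i => (l i : ℂ)) * Uᴴ) * U₀ := by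
          simp only [Matrix.mul_assoc]
      _ = Uᴴ * (U₀ * Matrix.diagonal (fun i => (l₀ i : ℂ)) * U₀ᴴ) * U₀ := this
      _ = Uᴴ * U₀ * Matrix.diagonal (fun i => (l₀ i : ℂ)) * (U₀ᴴ * U₀) := by
          simp only [Matrix.mul_assoc]
      _ = _ := by rw [h0.left, Matrix.mul_one]
  have e2 : Matrix.diagonal (fun i => ((l i ^ s : ℝ) : ℂ)) * W =
      W * Matrix.diagonal (fun i => ((l₀ i ^ s : ℝ) : ℂ)) := by
    ext i j
    have := congr_fun (congr_fun e1 i) j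
    rw [Matrix.diagonal_mul, Matrix.mul_diagonal] at this ⊢
    by_cases hz : W i j = 0
    · simp [hz]
    · rw [mul_comm] at this
      have := mul_left_cancel₀ hz this
      rw [Complex.ofReal_inj.1 this, mul_comm]
  calc U₀ * Matrix.diagonal (fun i => ((l₀ i ^ s : ℝ) : ℂ)) * U₀ᴴ
      = (U * Uᴴ) * U₀ * Matrix.diagonal (fun i => ((l₀ i ^ s : ℝ) : ℂ)) * U₀ᴴ := by
        rw [h.right, Matrix.one_mul]
    _ = U * (W * Matrix.diagonal (fun i => ((l₀ i ^ s : ℝ) : ℂ))) * U₀ᴴ := by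
        simp only [hW, Matrix.mul_assoc]
    _ = U * Matrix.diagonal (fun i => ((l i ^ s : ℝ) : ℂ)) * Uᴴ * (U₀ * U₀ᴴ) := by
        rw [← e2]; simp only [hW, Matrix.mul_assoc]
    _ = _ := by rw [h0.right, Matrix.mul_one]

lemma rotate_injective (h : Diagonalizes U l X) {A B : Matrix N N ℂ}
    (hAB : Uᴴ * A * U = Uᴴ * B * U) : A = B := by
  have : U * (Uᴴ * A * U) * Uᴴ = U * (Uᴴ * B * U) * Uᴴ := by rw [hAB]
  have e : ∀ C : Matrix N N ℂ, U * (Uᴴ * C * U) * Uᴴ = (U * Uᴴ) * C * (U * Uᴴ) := by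
    intro C; simp only [Matrix.mul_assoc]
  rwa [e, e, h.right, Matrix.one_mul, Matrix.one_mul, Matrix.mul_one, Matrix.mul_one] at this

lemma rotate_unrotate (h : Diagonalizes U l X) (A : Matrix N N ℂ) :
    Uᴴ * (U * A * Uᴴ) * U = A := by
  calc Uᴴ * (U * A * Uᴴ) * U = (Uᴴ * U) * A * (Uᴴ * U) := by simp only [Matrix.mul_assoc]
    _ = A := by rw [h.left, Matrix.one_mul, Matrix.mul_one]

lemma gns_rotate (h : Diagonalizes U l X) (A B : Matrix N N ℂ) :
    gns (Uᴴ * A * U) (Uᴴ * B * U) = gns A B := by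
  have : (Uᴴ * A * U)ᴴ * (Uᴴ * B * U) = Uᴴ * (Aᴴ * B * U) := by
    calc _ = Uᴴ * Aᴴ * (U * Uᴴ) * B * U := by
          simp only [conjTranspose_mul, conjTranspose_conjTranspose, Matrix.mul_assoc]
      _ = _ := by rw [h.right]; simp only [Matrix.mul_assoc, Matrix.one_mul]
  rw [gns, tau, this, Matrix.trace_mul_comm, Matrix.mul_assoc, h.right, Matrix.mul_one, gns, tau]

lemma trace_eq (h : Diagonalizes U l X) : X.trace = ((∑ i, l i : ℝ) : ℂ) := by
  rw [h.eq, Matrix.trace_mul_comm, ← Matrix.mul_assoc, h.left, Matrix.one_mul,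
    Matrix.trace_diagonal]
  push_cast; rfl

lemma nonneg (h : Diagonalizes U l X) (hX : X.PosSemidef) (i : N) : 0 ≤ l i := by
  have h1 := hX.conjTranspose_mul_mul_same U
  rw [h.eq, h.rotate_unrotate] at h1
  have := h1.diag_nonneg (i := i)
  rw [Matrix.diagonal_apply_eq] at this
  exact_mod_cast this

lemma pos (h : Diagonalizes U l X) (hX : X.PosDef) (i : N) : 0 < l i := by
  have h1 := hX.conjTranspose_mul_mul_same (B := U) (by
    intro x y hxy
    have : Uᴴ *ᵥ (U *ᵥ x) = Uᴴ *ᵥ (U *ᵥ y) := by rw [hxy]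
    simpa [Matrix.mulVec_mulVec, h.left] using this)
  rw [h.eq, h.rotate_unrotate] at h1
  have := h1.diag_pos (i := i)
  rw [Matrix.diagonal_apply_eq] at this
  exact_mod_cast this

lemma add_smul_one (h : Diagonalizes U l X) (a b : ℝ) :
    Diagonalizes U (fun i => a * l i + b) (a • X + b • (1 : Matrix N N ℂ)) where
  left := h.left
  right := h.right
  eq := by
    have : Matrix.diagonal (fun i => ((a * l i + b : ℝ) : ℂ)) =
        a • Matrix.diagonal (fun i => (l i : ℂ)) + b • (1 : Matrix N N ℂ) := by
      ext i j
      by_cases hij : i = j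
      · subst hij; simp
      · simp [Matrix.diagonal_apply_ne _ hij, Matrix.one_apply_ne hij]
    rw [this, Matrix.mul_add, Matrix.add_mul, Matrix.mul_smul, Matrix.smul_mul, ← h.eq,
      Matrix.mul_smul, Matrix.smul_mul, Matrix.mul_one, h.right]

end Diagonalizes

/-- Scalar kernel of the operator `[X]_α` at a pair of eigenvalues. -/
noncomputable def sandwichKernel (α a b : ℝ) : ℝ :=
  ∫ s in (0:ℝ)..1, Real.exp (α * (s - 1 / 2)) * (a ^ s * b ^ (1 - s))

lemma intervalIntegrable_sandwichKernel (α : ℝ) {a b : ℝ} (ha : 0 ≤ a) (hb : 0 ≤ b) :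
    IntervalIntegrable (fun s => Real.exp (α * (s - 1 / 2)) * (a ^ s * b ^ (1 - s))) volume 0 1 := by
  rw [intervalIntegrable_iff_integrableOn_Icc_of_le zero_le_one]
  have hp : ∀ x : ℝ, 0 ≤ x → ∀ s ∈ Set.Icc (0:ℝ) 1, x ^ s ≤ 1 + x := by
    intro x hx s hs
    calc x ^ s ≤ (1 + x) ^ s := Real.rpow_le_rpow hx (by linarith) hs.1
      _ ≤ (1 + x) ^ (1:ℝ) := Real.rpow_le_rpow_of_exponent_le (by linarith) hs.2
      _ = 1 + x := Real.rpow_one _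
  have hmeas : Measurable fun s : ℝ => a ^ s * b ^ (1 - s) := by fun_prop
  have hint : IntegrableOn (fun s : ℝ => a ^ s * b ^ (1 - s)) (Set.Icc 0 1) := by
    refine Measure.integrableOn_of_bounded (M := (1 + a) * (1 + b)) (by simp)
      hmeas.aestronglyMeasurable ?_
    filter_upwards [ae_restrict_mem measurableSet_Icc] with s hs
    have h1 : 0 ≤ a ^ s := Real.rpow_nonneg ha _
    have h2 : 0 ≤ b ^ (1 - s) := Real.rpow_nonneg hb _
    rw [Real.norm_eq_abs, abs_of_nonneg (mul_nonneg h1 h2)]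
    exact mul_le_mul (hp a ha s hs) (hp b hb _ ⟨by linarith [hs.2], by linarith [hs.1]⟩) h2
      (by linarith)
  exact hint.continuousOn_mul (Continuous.continuousOn (by fun_prop)) isCompact_Icc

lemma sandwichKernel_nonneg (α : ℝ) {a b : ℝ} (ha : 0 ≤ a) (hb : 0 ≤ b) :
    0 ≤ sandwichKernel α a b :=
  intervalIntegral.integral_nonneg zero_le_one fun _ _ =>
    mul_nonneg (Real.exp_pos _).le (mul_nonneg (Real.rpow_nonneg ha _) (Real.rpow_nonneg hb _))

lemma sandwichKernel_neg (α a b : ℝ) : sandwichKernel (-α) a b = sandwichKernel α b a := by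
  have h := intervalIntegral.integral_comp_sub_left (a := 0) (b := 1)
    (fun s => Real.exp (α * (s - 1 / 2)) * (b ^ s * a ^ (1 - s))) 1
  rw [sub_self, sub_zero] at h
  rw [sandwichKernel, sandwichKernel, ← h]
  congr 1
  ext s
  rw [sub_sub_cancel, mul_comm (a ^ s)]
  congr 2
  ring

lemma sandwichKernel_mono (α : ℝ) {a b a' b' : ℝ} (ha : 0 ≤ a) (hb : 0 ≤ b) (haa : a ≤ a')
    (hbb : b ≤ b') : sandwichKernel α a b ≤ sandwichKernel α a' b' := by
  apply intervalIntegral.integral_mono_on zero_le_one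
    (intervalIntegrable_sandwichKernel α ha hb)
    (intervalIntegrable_sandwichKernel α (ha.trans haa) (hb.trans hbb))
  intro s hs
  apply mul_le_mul_of_nonneg_left _ (Real.exp_pos _).le
  exact mul_le_mul (Real.rpow_le_rpow ha haa hs.1)
    (Real.rpow_le_rpow hb hbb (by linarith [hs.2])) (Real.rpow_nonneg hb _)
    (Real.rpow_nonneg (ha.trans haa) _)

lemma sandwichKernel_smul (α : ℝ) {r a b : ℝ} (hr : 0 < r) (ha : 0 ≤ a) (hb : 0 ≤ b) :
    sandwichKernel α (r * a) (r * b) = r * sandwichKernel α a b := by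
  rw [sandwichKernel, sandwichKernel, ← intervalIntegral.integral_const_mul]
  congr 1
  ext s
  rw [Real.mul_rpow hr.le ha, Real.mul_rpow hr.le hb]
  have : r ^ s * r ^ (1 - s) = r := by
    rw [← Real.rpow_add hr, add_sub_cancel, Real.rpow_one]
  calc _ = Real.exp (α * (s - 1 / 2)) * (a ^ s * b ^ (1 - s)) * (r ^ s * r ^ (1 - s)) := by ring
    _ = _ := by rw [this]; ring

/-- The kernel is a logarithmic mean, the reciprocal of which is an average of reciprocals of
linear functions. -/
lemma sandwichKernel_mul_integral (α : ℝ) {a b : ℝ} (ha : 0 < a) (hb : 0 < b) :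
    sandwichKernel α a b *
      ∫ u in (0:ℝ)..1, (u * (Real.exp (α / 2) * a) + (1 - u) * (Real.exp (-α / 2) * b))⁻¹ = 1 := by
  set A := Real.exp (α / 2) * a with hA
  set B := Real.exp (-α / 2) * b with hB
  have hApos : 0 < A := by positivity
  have hBpos : 0 < B := by positivity
  have hlA : Real.log A = α / 2 + Real.log a := by
    rw [hA, Real.log_mul (Real.exp_pos _).ne' ha.ne', Real.log_exp]
  have hlB : Real.log B = -α / 2 + Real.log b := by
    rw [hB, Real.log_mul (Real.exp_pos _).ne' hb.ne', Real.log_exp]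
  have hker : sandwichKernel α a b =
      ∫ s in (0:ℝ)..1, Real.exp (s * Real.log A + (1 - s) * Real.log B) := by
    rw [sandwichKernel]
    congr 1
    ext s
    rw [Real.rpow_def_of_pos ha, Real.rpow_def_of_pos hb, ← Real.exp_add, ← Real.exp_add, hlA, hlB]
    congr 1
    ring
  rw [hker]
  have hpos : ∀ u ∈ Set.Icc (0:ℝ) 1, 0 < u * A + (1 - u) * B := by
    intro u hu
    rcases eq_or_lt_of_le hu.1 with h | h
    · rw [← h]; simpa using hBpos
    · exact add_pos_of_pos_of_nonneg (mul_pos h hApos)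
        (mul_nonneg (by linarith [hu.2]) hBpos.le)
  by_cases hAB : A = B
  · rw [hAB]
    have e1 : ∀ s : ℝ, s * Real.log B + (1 - s) * Real.log B = Real.log B := fun s => by ring
    have e2 : ∀ s : ℝ, s * B + (1 - s) * B = B := fun s => by ring
    simp only [e1, e2, intervalIntegral.integral_const, Real.exp_log hBpos]
    simp [hBpos.ne']
  · have hl : Real.log A - Real.log B ≠ 0 := fun h =>
      hAB (Real.log_injOn_pos hApos hBpos (sub_eq_zero.1 h))
    have h1 : (Real.log A - Real.log B) *
        ∫ s in (0:ℝ)..1, Real.exp (s * Real.log A + (1 - s) * Real.log B) = A - B := by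
      rw [← intervalIntegral.integral_const_mul]
      have hd : ∀ s ∈ Set.uIcc (0:ℝ) 1,
          HasDerivAt (fun s => Real.exp (s * Real.log A + (1 - s) * Real.log B))
          ((Real.log A - Real.log B) * Real.exp (s * Real.log A + (1 - s) * Real.log B)) s := by
        intro s _
        have := (((hasDerivAt_id s).mul_const (Real.log A)).add
          (((hasDerivAt_id s).const_sub 1).mul_const (Real.log B))).exp
        simp only [id_eq, Pi.add_apply] at this
        convert this using 1
        ring
      rw [intervalIntegral.integral_eq_sub_of_hasDerivAt hd
        (Continuous.intervalIntegrable (by fun_prop) _ _)]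
      simp [Real.exp_log hApos, Real.exp_log hBpos]
    have h2 : (A - B) * ∫ u in (0:ℝ)..1, (u * A + (1 - u) * B)⁻¹ = Real.log A - Real.log B := by
      rw [← intervalIntegral.integral_const_mul]
      have hd : ∀ u ∈ Set.uIcc (0:ℝ) 1,
          HasDerivAt (fun u => Real.log (u * A + (1 - u) * B))
          ((A - B) * (u * A + (1 - u) * B)⁻¹) u := by
        intro u hu
        rw [Set.uIcc_of_le zero_le_one] at hu
        have := (((hasDerivAt_id u).mul_const A).add
          (((hasDerivAt_id u).const_sub 1).mul_const B)).log (hpos u hu).ne'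
        simp only [id_eq, Pi.add_apply] at this
        convert this using 1
        rw [div_eq_mul_inv]
        congr 1
        ring
      rw [intervalIntegral.integral_eq_sub_of_hasDerivAt hd]
      · simp
      · apply ContinuousOn.intervalIntegrable
        rw [Set.uIcc_of_le zero_le_one]
        exact continuousOn_const.mul (ContinuousOn.inv₀ (by fun_prop) fun u hu => (hpos u hu).ne')
    have h3 : A - B ≠ 0 := sub_ne_zero.2 hAB
    apply mul_left_cancel₀ (mul_ne_zero hl h3)
    calc _ = ((Real.log A - Real.log B) *
        ∫ s in (0:ℝ)..1, Real.exp (s * Real.log A + (1 - s) * Real.log B)) *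
        ((A - B) * ∫ u in (0:ℝ)..1, (u * A + (1 - u) * B)⁻¹) := by ring
      _ = _ := by rw [h1, h2]; ring

lemma sandwichKernel_pos (α : ℝ) {a b : ℝ} (ha : 0 < a) (hb : 0 < b) :
    0 < sandwichKernel α a b :=
  lt_of_le_of_ne (sandwichKernel_nonneg α ha.le hb.le) fun h => by
    have := sandwichKernel_mul_integral α ha hb
    rw [← h, zero_mul] at this
    exact zero_ne_one this

lemma sandwichKernel_le (α : ℝ) {a b m : ℝ} (ha : 0 ≤ a) (hb : 0 ≤ b) (ham : a ≤ m) (hbm : b ≤ m)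
    (hm : 0 < m) : sandwichKernel α a b ≤ m * Real.exp |α| := by
  refine (sandwichKernel_mono α ha hb ham hbm).trans ?_
  have h1 : sandwichKernel α m m = m * sandwichKernel α 1 1 := by
    simpa using sandwichKernel_smul α hm zero_le_one zero_le_one
  rw [h1]
  apply mul_le_mul_of_nonneg_left _ hm.le
  calc sandwichKernel α 1 1 ≤ ∫ s in (0:ℝ)..1, Real.exp |α| := by
        apply intervalIntegral.integral_mono_on zero_le_one
          (intervalIntegrable_sandwichKernel α zero_le_one zero_le_one)
          (continuous_const.intervalIntegrable _ _)
        intro s hs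
        simp only [Real.one_rpow, mul_one]
        apply Real.exp_le_exp.2
        refine (le_abs_self _).trans ?_
        rw [abs_mul]
        have : |s - 1 / 2| ≤ 1 := abs_le.2 ⟨by linarith [hs.1], by linarith [hs.2]⟩
        nlinarith [abs_nonneg α]
    _ = Real.exp |α| := by simp

end Spectral

section Sandwich

variable {N : Type*} [Fintype N] [DecidableEq N]

namespace Diagonalizes

variable {U X : Matrix N N ℂ} {l : N → ℝ}

lemma sandwich_eq (h : Diagonalizes U l X) (hl : ∀ i, 0 ≤ l i) (α : ℝ) (W : Matrix N N ℂ) :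
    sandwich X α W = U * (Matrix.of fun a b =>
      (sandwichKernel α (l a) (l b) : ℂ) * (Uᴴ * W * U) a b) * Uᴴ := by
  ext i k
  set R := Uᴴ * W * U with hR
  have hentry : ∀ s : ℝ, Real.exp (α * (s - 1 / 2)) • ((mpow X s * W * mpow X (1 - s)) i k) =
      ∑ b, ∑ a, (U i a * R a b * Uᴴ b k) *
        ((Real.exp (α * (s - 1 / 2)) * (l a ^ s * l b ^ (1 - s)) : ℝ) : ℂ) := by
    intro s
    have e : mpow X s * W * mpow X (1 - s) = U * (Matrix.diagonal (fun i => ((l i ^ s : ℝ) : ℂ)) * R *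
        Matrix.diagonal (fun i => ((l i ^ (1 - s) : ℝ) : ℂ))) * Uᴴ := by
      rw [h.mpow_eq, h.mpow_eq, hR]
      simp only [Matrix.mul_assoc]
    rw [e, Matrix.mul_apply, Finset.smul_sum]
    refine Finset.sum_congr rfl fun b _ => ?_
    rw [Matrix.mul_apply, Finset.sum_mul, Finset.smul_sum]
    refine Finset.sum_congr rfl fun a _ => ?_
    rw [Matrix.mul_diagonal, Matrix.diagonal_mul, Complex.real_smul]
    push_cast
    ring
  have hint : ∀ a b, IntervalIntegrable (fun s : ℝ => (U i a * R a b * Uᴴ b k) *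
      ((Real.exp (α * (s - 1 / 2)) * (l a ^ s * l b ^ (1 - s)) : ℝ) : ℂ)) volume 0 1 := by
    intro a b
    have := intervalIntegrable_sandwichKernel α (hl a) (hl b)
    rw [intervalIntegrable_iff] at this ⊢
    exact (Integrable.ofReal (𝕜 := ℂ) this).const_mul _
  have hsum : ∀ b, IntervalIntegrable (fun s : ℝ => ∑ a, (U i a * R a b * Uᴴ b k) *
      ((Real.exp (α * (s - 1 / 2)) * (l a ^ s * l b ^ (1 - s)) : ℝ) : ℂ)) volume 0 1 := by
    intro b
    simp only [intervalIntegrable_iff] at hint ⊢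
    exact integrable_finsetSum _ fun a _ => hint a b
  rw [sandwich, Matrix.of_apply]
  simp_rw [hentry]
  rw [intervalIntegral.integral_finsetSum
    (fun b _ => hsum b), Matrix.mul_apply]
  refine Finset.sum_congr rfl fun b _ => ?_
  rw [intervalIntegral.integral_finsetSum (fun a _ => hint a b), Matrix.mul_apply, Finset.sum_mul]
  refine Finset.sum_congr rfl fun a _ => ?_
  rw [intervalIntegral.integral_const_mul, intervalIntegral.integral_ofReal, Matrix.of_apply,
    sandwichKernel]
  ring

lemma rotate_sandwich (h : Diagonalizes U l X) (hl : ∀ i, 0 ≤ l i) (α : ℝ) (W : Matrix N N ℂ) :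
    Uᴴ * sandwich X α W * U = Matrix.of fun a b =>
      (sandwichKernel α (l a) (l b) : ℂ) * (Uᴴ * W * U) a b := by
  rw [h.sandwich_eq hl, h.rotate_unrotate]

lemma sandwich_conjTranspose (h : Diagonalizes U l X) (hl : ∀ i, 0 ≤ l i) (α : ℝ)
    (W : Matrix N N ℂ) : (sandwich X α W)ᴴ = sandwich X (-α) Wᴴ := by
  rw [h.sandwich_eq hl, h.sandwich_eq hl, conjTranspose_mul, conjTranspose_mul,
    conjTranspose_conjTranspose, ← Matrix.mul_assoc]
  congr 2
  ext a b
  have : Uᴴ * Wᴴ * U = (Uᴴ * W * U)ᴴ := by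
    simp only [conjTranspose_mul, conjTranspose_conjTranspose, Matrix.mul_assoc]
  rw [this, conjTranspose_apply, Matrix.of_apply, Matrix.of_apply, conjTranspose_apply,
    sandwichKernel_neg, star_mul', Complex.star_def, Complex.conj_ofReal]

lemma re_gns_sandwich (h : Diagonalizes U l X) (hl : ∀ i, 0 ≤ l i) (α : ℝ) (W : Matrix N N ℂ) :
    (gns W (sandwich X α W)).re =
      (∑ a, ∑ b, sandwichKernel α (l a) (l b) * ‖(Uᴴ * W * U) a b‖ ^ 2) / Fintype.card N := by
  rw [← h.gns_rotate, h.rotate_sandwich hl, gns_eq_sum, Complex.div_natCast_re, Complex.re_sum]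
  congr 1
  refine Finset.sum_congr rfl fun a _ => ?_
  rw [Complex.re_sum]
  refine Finset.sum_congr rfl fun b _ => ?_
  rw [Matrix.of_apply, mul_left_comm, Complex.re_ofReal_mul, Complex.star_def, Complex.conj_mul']
  norm_cast

lemma sandwich_interpolate (h : Diagonalizes U l X) (hl : ∀ i, 0 ≤ l i) (α : ℝ)
    (W : Matrix N N ℂ) {r : ℝ} (hr : 0 < r) (hr1 : r < 1) :
    (1 - r) * (gns W (sandwich X α W)).re ≤
      (gns W (sandwich ((1 - r) • X + r • (1 : Matrix N N ℂ)) α W)).re := by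
  have h1 : 0 < 1 - r := by linarith
  rw [h.re_gns_sandwich hl, (h.add_smul_one (1 - r) r).re_gns_sandwich
    (fun i => add_nonneg (mul_nonneg h1.le (hl i)) hr.le), ← mul_div_assoc]
  refine div_le_div_of_nonneg_right ?_ (Nat.cast_nonneg _)
  rw [Finset.mul_sum]
  refine Finset.sum_le_sum fun a _ => ?_
  rw [Finset.mul_sum]
  refine Finset.sum_le_sum fun b _ => ?_
  rw [← mul_assoc, ← sandwichKernel_smul α h1 (hl a) (hl b)]
  exact mul_le_mul_of_nonneg_right (sandwichKernel_mono α (mul_nonneg h1.le (hl a))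
    (mul_nonneg h1.le (hl b)) (by linarith) (by linarith)) (sq_nonneg _)

end Diagonalizes

/-- The quadratic form `⟨V, [X]_α⁻¹ V⟩` of a positive definite matrix `X`. -/
noncomputable def invAction (X : Matrix N N ℂ) (α : ℝ) (V : Matrix N N ℂ) : ℝ :=
  if hX : X.IsHermitian then
    (∑ a, ∑ b, ‖((hX.eigenvectorUnitary : Matrix N N ℂ)ᴴ * V * hX.eigenvectorUnitary) a b‖ ^ 2 /
      sandwichKernel α (hX.eigenvalues a) (hX.eigenvalues b)) / Fintype.card N
  else 0

/-- A diagonalization of a positive definite matrix, computing the associated quadratic forms. -/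
lemma Matrix.PosDef.exists_diagonalizes {X : Matrix N N ℂ} (hX : X.PosDef) :
    ∃ U l, Diagonalizes U l X ∧ (∀ i, 0 < l i) ∧ ∀ α V, invAction X α V =
      (∑ a, ∑ b, ‖(Uᴴ * V * U) a b‖ ^ 2 / sandwichKernel α (l a) (l b)) / Fintype.card N :=
  ⟨_, _, hX.1.diagonalizes, hX.1.diagonalizes.pos hX, fun α V => by rw [invAction, dif_pos hX.1]⟩

variable {X : Matrix N N ℂ}

lemma Matrix.PosSemidef.sandwich_conjTranspose (hX : X.PosSemidef) (α : ℝ) (W : Matrix N N ℂ) :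
    (sandwich X α W)ᴴ = sandwich X (-α) Wᴴ :=
  hX.1.diagonalizes.sandwich_conjTranspose (hX.1.diagonalizes.nonneg hX) α W

lemma Matrix.PosDef.sandwich_injective (hX : X.PosDef) (α : ℝ) :
    Function.Injective (sandwich X α) := by
  obtain ⟨U, l, h, hl, -⟩ := hX.exists_diagonalizes
  intro W W' hW
  apply h.rotate_injective
  have h1 := h.rotate_sandwich (fun i => (hl i).le) α W
  rw [hW, h.rotate_sandwich (fun i => (hl i).le)] at h1
  ext a b
  have h2 := congr_fun (congr_fun h1 a) b
  rw [Matrix.of_apply, Matrix.of_apply] at h2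
  exact (mul_left_cancel₀ (Complex.ofReal_ne_zero.2 (sandwichKernel_pos α (hl a) (hl b)).ne')
    h2).symm

lemma Matrix.PosDef.sandwich_surjective (hX : X.PosDef) (α : ℝ) :
    Function.Surjective (sandwich X α) := by
  obtain ⟨U, l, h, hl, -⟩ := hX.exists_diagonalizes
  intro V
  refine ⟨U * (Matrix.of fun a b => (Uᴴ * V * U) a b / (sandwichKernel α (l a) (l b) : ℂ)) * Uᴴ, ?_⟩
  apply h.rotate_injective
  rw [h.rotate_sandwich (fun i => (hl i).le), h.rotate_unrotate]
  ext a b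
  rw [Matrix.of_apply, Matrix.of_apply, mul_div_cancel₀]
  exact Complex.ofReal_ne_zero.2 (sandwichKernel_pos α (hl a) (hl b)).ne'

lemma Matrix.PosDef.re_gns_sandwich_eq_invAction (hX : X.PosDef) (α : ℝ) (W : Matrix N N ℂ) :
    (gns W (sandwich X α W)).re = invAction X α (sandwich X α W) := by
  obtain ⟨U, l, h, hl, hinv⟩ := hX.exists_diagonalizes
  rw [hinv, h.re_gns_sandwich (fun i => (hl i).le), h.rotate_sandwich (fun i => (hl i).le)]
  congr 1
  refine Finset.sum_congr rfl fun a _ => Finset.sum_congr rfl fun b _ => ?_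
  have hk := sandwichKernel_pos α (hl a) (hl b)
  rw [Matrix.of_apply, norm_mul, Complex.norm_real, Real.norm_of_nonneg hk.le]
  field_simp

lemma Matrix.PosDef.re_gns_le (hX : X.PosDef) (α : ℝ) (V G : Matrix N N ℂ) :
    (gns V G).re ≤ invAction X α V / 2 + (gns G (sandwich X α G)).re / 2 := by
  obtain ⟨U, l, h, hl, hinv⟩ := hX.exists_diagonalizes
  rw [hinv, h.re_gns_sandwich (fun i => (hl i).le), ← h.gns_rotate, gns_eq_sum,
    Complex.div_natCast_re, Complex.re_sum, ← add_div, ← add_div, div_right_comm]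
  refine div_le_div_of_nonneg_right ?_ (Nat.cast_nonneg _)
  rw [← Finset.sum_add_distrib, Finset.sum_div]
  refine Finset.sum_le_sum fun a _ => ?_
  rw [← Finset.sum_add_distrib, Finset.sum_div, Complex.re_sum]
  refine Finset.sum_le_sum fun b _ => ?_
  set v := (Uᴴ * V * U) a b
  set g := (Uᴴ * G * U) a b
  have hk := sandwichKernel_pos α (hl a) (hl b)
  set k := sandwichKernel α (l a) (l b)
  have h1 : (star v * g).re ≤ ‖v‖ * ‖g‖ := by
    refine (Complex.re_le_norm _).trans ?_
    rw [norm_mul, norm_star]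
  refine h1.trans ?_
  rw [le_div_iff₀ two_pos]
  have h2 : 0 ≤ (‖v‖ - k * ‖g‖) ^ 2 / k := by positivity
  have h3 : (‖v‖ - k * ‖g‖) ^ 2 / k = ‖v‖ ^ 2 / k + k * ‖g‖ ^ 2 - ‖v‖ * ‖g‖ * 2 := by
    field_simp
    ring
  linarith

lemma Matrix.PosDef.invAction_nonneg (hX : X.PosDef) (α : ℝ) (V : Matrix N N ℂ) :
    0 ≤ invAction X α V := by
  obtain ⟨U, l, h, hl, hinv⟩ := hX.exists_diagonalizes
  rw [hinv]
  refine div_nonneg (Finset.sum_nonneg fun a _ => Finset.sum_nonneg fun b _ => ?_)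
    (Nat.cast_nonneg _)
  exact div_nonneg (sq_nonneg _) (sandwichKernel_pos α (hl a) (hl b)).le

lemma Matrix.PosDef.invAction_smul (hX : X.PosDef) (α r : ℝ) (V : Matrix N N ℂ) :
    invAction X α (r • V) = r ^ 2 * invAction X α V := by
  obtain ⟨U, l, h, hl, hinv⟩ := hX.exists_diagonalizes
  rw [hinv, hinv, ← mul_div_assoc, Finset.mul_sum]
  congr 1
  refine Finset.sum_congr rfl fun a _ => ?_
  rw [Finset.mul_sum]
  refine Finset.sum_congr rfl fun b _ => ?_
  rw [Matrix.mul_smul, Matrix.smul_mul, Matrix.smul_apply, norm_smul, mul_pow, Real.norm_eq_abs,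
    sq_abs, mul_div_assoc]

lemma Diagonalizes.eigenvalue_le [Nonempty N] {U : Matrix N N ℂ} {l : N → ℝ}
    (h : Diagonalizes U l X) (hl : ∀ i, 0 ≤ l i) (ht : tau X = 1) (i : N) :
    l i ≤ Fintype.card N := by
  have hn : (Fintype.card N : ℂ) ≠ 0 := by exact_mod_cast Fintype.card_ne_zero
  rw [tau, div_eq_one_iff_eq hn, h.trace_eq] at ht
  have : ∑ i, l i = Fintype.card N := by exact_mod_cast ht
  rw [← this]
  exact Finset.single_le_sum (fun i _ => hl i) (Finset.mem_univ i)

lemma Matrix.PosDef.le_invAction [Nonempty N] (hX : X.PosDef) (ht : tau X = 1) (α : ℝ)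
    (V : Matrix N N ℂ) (i j : N) :
    ‖V i j‖ ^ 2 / (Fintype.card N * Real.exp |α| * Fintype.card N) ≤ invAction X α V := by
  obtain ⟨U, l, h, hl, hinv⟩ := hX.exists_diagonalizes
  have hn : (0:ℝ) < Fintype.card N := by exact_mod_cast Fintype.card_pos
  have hle := h.eigenvalue_le (fun i => (hl i).le) ht
  rw [hinv, ← div_div]
  refine div_le_div_of_nonneg_right ?_ (Nat.cast_nonneg _)
  have hrot : ∑ a, ∑ b, ‖V a b‖ ^ 2 = ∑ a, ∑ b, ‖(Uᴴ * V * U) a b‖ ^ 2 := by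
    have := gns_self_re V
    rw [← h.gns_rotate, gns_self_re] at this
    exact ((div_left_inj' hn.ne').1 this).symm
  calc ‖V i j‖ ^ 2 / (Fintype.card N * Real.exp |α|)
      ≤ (∑ a, ∑ b, ‖V a b‖ ^ 2) / (Fintype.card N * Real.exp |α|) := by
        refine div_le_div_of_nonneg_right ?_ (by positivity)
        exact (Finset.single_le_sum (f := fun b => ‖V i b‖ ^ 2) (fun b _ => sq_nonneg _)
          (Finset.mem_univ j)).trans
          (Finset.single_le_sum (f := fun a => ∑ b, ‖V a b‖ ^ 2)
            (fun a _ => Finset.sum_nonneg fun b _ => sq_nonneg _) (Finset.mem_univ i))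
    _ = ∑ a, ∑ b, ‖(Uᴴ * V * U) a b‖ ^ 2 / (Fintype.card N * Real.exp |α|) := by
        rw [hrot]
        simp only [Finset.sum_div]
    _ ≤ _ := by
        refine Finset.sum_le_sum fun a _ => Finset.sum_le_sum fun b _ => ?_
        exact div_le_div_of_nonneg_left (sq_nonneg _) (sandwichKernel_pos α (hl a) (hl b))
          (sandwichKernel_le α (hl a).le (hl b).le (hle a) (hle b) hn)

end Sandwich

section Convexity

variable {N : Type*} [Fintype N] [DecidableEq N]

/-- Quadratic form of the operator `B ↦ u e^{α/2} X B + (1 - u) e^{-α/2} B X`, which is linear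
in `X`. -/
noncomputable def linearForm (α u : ℝ) (X B : Matrix N N ℂ) : ℝ :=
  u * Real.exp (α / 2) * (gns B (X * B)).re + (1 - u) * Real.exp (-α / 2) * (gns B (B * X)).re

lemma gns_add_right (A B C : Matrix N N ℂ) : gns A (B + C) = gns A B + gns A C := by
  simp only [gns, tau, Matrix.mul_add, Matrix.trace_add, add_div]

lemma gns_smul_right (r : ℝ) (A B : Matrix N N ℂ) : gns A (r • B) = r * gns A B := by
  simp only [gns, tau, Matrix.mul_smul, Matrix.trace_smul, Complex.real_smul, mul_div_assoc]

lemma linearForm_combo (α u a b : ℝ) (X Y B : Matrix N N ℂ) :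
    linearForm α u (a • X + b • Y) B = a * linearForm α u X B + b * linearForm α u Y B := by
  simp only [linearForm, Matrix.add_mul, Matrix.mul_add, Matrix.smul_mul, Matrix.mul_smul,
    gns_add_right, gns_smul_right, Complex.add_re, Complex.re_ofReal_mul]
  ring

/-- Eigenvalues of the operator underlying `linearForm`. -/
noncomputable def linearKernel (α u a b : ℝ) : ℝ :=
  u * (Real.exp (α / 2) * a) + (1 - u) * (Real.exp (-α / 2) * b)

lemma linearKernel_pos (α : ℝ) {u a b : ℝ} (hu : u ∈ Set.Icc (0:ℝ) 1) (ha : 0 < a) (hb : 0 < b) :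
    0 < linearKernel α u a b := by
  rw [linearKernel]
  rcases eq_or_lt_of_le hu.1 with h | h
  · rw [← h]; simp only [zero_mul, sub_zero, one_mul, zero_add]; positivity
  · exact add_pos_of_pos_of_nonneg (by positivity)
      (mul_nonneg (by linarith [hu.2]) (by positivity))

lemma continuousOn_linearKernel_inv (α : ℝ) {a b : ℝ} (ha : 0 < a) (hb : 0 < b) :
    ContinuousOn (fun u => (linearKernel α u a b)⁻¹) (Set.Icc 0 1) := by
  refine ContinuousOn.inv₀ ?_ fun u hu => (linearKernel_pos α hu ha hb).ne'
  unfold linearKernel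
  fun_prop

lemma sandwichKernel_inv (α : ℝ) {a b : ℝ} (ha : 0 < a) (hb : 0 < b) :
    (sandwichKernel α a b)⁻¹ = ∫ u in (0:ℝ)..1, (linearKernel α u a b)⁻¹ :=
  (eq_inv_of_mul_eq_one_right (sandwichKernel_mul_integral α ha hb)).symm

/-- Quadratic form of the inverse of the operator underlying `linearForm`, in a diagonalizing
basis. -/
noncomputable def linearInvForm (U : Matrix N N ℂ) (l : N → ℝ) (α : ℝ) (V : Matrix N N ℂ)
    (u : ℝ) : ℝ :=
  (∑ a, ∑ b, ‖(Uᴴ * V * U) a b‖ ^ 2 * (linearKernel α u (l a) (l b))⁻¹) / Fintype.card N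

lemma continuousOn_linearInvForm (U : Matrix N N ℂ) {l : N → ℝ} (hl : ∀ i, 0 < l i) (α : ℝ)
    (V : Matrix N N ℂ) : ContinuousOn (linearInvForm U l α V) (Set.Icc 0 1) := by
  unfold linearInvForm
  refine ContinuousOn.div_const (continuousOn_finsetSum _ fun a _ =>
    continuousOn_finsetSum _ fun b _ => ?_) _
  exact continuousOn_const.mul (continuousOn_linearKernel_inv α (hl a) (hl b))

lemma intervalIntegrable_linearInvForm (U : Matrix N N ℂ) {l : N → ℝ} (hl : ∀ i, 0 < l i) (α : ℝ)
    (V : Matrix N N ℂ) : IntervalIntegrable (linearInvForm U l α V) volume 0 1 :=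
  ContinuousOn.intervalIntegrable
    (by rw [Set.uIcc_of_le zero_le_one]; exact continuousOn_linearInvForm U hl α V)

lemma integral_linearInvForm (U : Matrix N N ℂ) {l : N → ℝ} (hl : ∀ i, 0 < l i) (α : ℝ)
    (V : Matrix N N ℂ) : ∫ u in (0:ℝ)..1, linearInvForm U l α V u =
      (∑ a, ∑ b, ‖(Uᴴ * V * U) a b‖ ^ 2 / sandwichKernel α (l a) (l b)) / Fintype.card N := by
  have hi : ∀ a b, IntervalIntegrable
      (fun u => ‖(Uᴴ * V * U) a b‖ ^ 2 * (linearKernel α u (l a) (l b))⁻¹) volume 0 1 := fun a b =>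
    ContinuousOn.intervalIntegrable (by
      rw [Set.uIcc_of_le zero_le_one]
      exact continuousOn_const.mul (continuousOn_linearKernel_inv α (hl a) (hl b)))
  have hs : ∀ a, IntervalIntegrable
      (fun u => ∑ b, ‖(Uᴴ * V * U) a b‖ ^ 2 * (linearKernel α u (l a) (l b))⁻¹) volume 0 1 := by
    intro a
    simp only [intervalIntegrable_iff] at hi ⊢
    exact integrable_finsetSum _ fun b _ => hi a b
  simp only [linearInvForm]
  rw [intervalIntegral.integral_div, intervalIntegral.integral_finsetSum fun a _ => hs a]
  congr 1
  refine Finset.sum_congr rfl fun a _ => ?_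
  rw [intervalIntegral.integral_finsetSum fun b _ => hi a b]
  refine Finset.sum_congr rfl fun b _ => ?_
  rw [intervalIntegral.integral_const_mul, div_eq_mul_inv, sandwichKernel_inv α (hl a) (hl b)]

namespace Diagonalizes

variable {U X : Matrix N N ℂ} {l : N → ℝ}

lemma linearForm_eq (h : Diagonalizes U l X) (α u : ℝ) (B : Matrix N N ℂ) :
    linearForm α u X B =
      (∑ a, ∑ b, linearKernel α u (l a) (l b) * ‖(Uᴴ * B * U) a b‖ ^ 2) / Fintype.card N := by
  have e1 : Uᴴ * (X * B) * U = Matrix.diagonal (fun i => (l i : ℂ)) * (Uᴴ * B * U) := by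
    conv_lhs => rw [h.eq]
    calc _ = (Uᴴ * U) * Matrix.diagonal (fun i => (l i : ℂ)) * (Uᴴ * B * U) := by
          simp only [Matrix.mul_assoc]
      _ = _ := by rw [h.left, Matrix.one_mul]
  have e2 : Uᴴ * (B * X) * U = (Uᴴ * B * U) * Matrix.diagonal (fun i => (l i : ℂ)) := by
    conv_lhs => rw [h.eq]
    calc _ = (Uᴴ * B * U) * Matrix.diagonal (fun i => (l i : ℂ)) * (Uᴴ * U) := by
          simp only [Matrix.mul_assoc]
      _ = _ := by rw [h.left, Matrix.mul_one]
  have f1 : (gns B (X * B)).re = (∑ a, ∑ b, l a * ‖(Uᴴ * B * U) a b‖ ^ 2) / Fintype.card N := by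
    rw [← h.gns_rotate, e1, gns_eq_sum, Complex.div_natCast_re, Complex.re_sum]
    congr 1
    refine Finset.sum_congr rfl fun a _ => ?_
    rw [Complex.re_sum]
    refine Finset.sum_congr rfl fun b _ => ?_
    rw [Matrix.diagonal_mul, mul_left_comm, Complex.re_ofReal_mul, Complex.star_def,
      Complex.conj_mul']
    norm_cast
  have f2 : (gns B (B * X)).re = (∑ a, ∑ b, l b * ‖(Uᴴ * B * U) a b‖ ^ 2) / Fintype.card N := by
    rw [← h.gns_rotate, e2, gns_eq_sum, Complex.div_natCast_re, Complex.re_sum]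
    congr 1
    refine Finset.sum_congr rfl fun a _ => ?_
    rw [Complex.re_sum]
    refine Finset.sum_congr rfl fun b _ => ?_
    rw [Matrix.mul_diagonal, ← mul_assoc, mul_comm, Complex.re_ofReal_mul, Complex.star_def,
      Complex.conj_mul']
    norm_cast
  rw [linearForm, f1, f2, ← mul_div_assoc, ← mul_div_assoc, ← add_div]
  congr 1
  rw [Finset.mul_sum, Finset.mul_sum, ← Finset.sum_add_distrib]
  refine Finset.sum_congr rfl fun a _ => ?_
  rw [Finset.mul_sum, Finset.mul_sum, ← Finset.sum_add_distrib]
  refine Finset.sum_congr rfl fun b _ => ?_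
  rw [linearKernel]
  ring

lemma re_gns_eq (h : Diagonalizes U l X) (B V : Matrix N N ℂ) : (gns B V).re =
    (∑ a, ∑ b, (star ((Uᴴ * B * U) a b) * (Uᴴ * V * U) a b).re) / Fintype.card N := by
  rw [← h.gns_rotate, gns_eq_sum, Complex.div_natCast_re, Complex.re_sum]
  simp only [Complex.re_sum]

lemma two_mul_re_gns_sub_linearForm_le (h : Diagonalizes U l X) (hl : ∀ i, 0 < l i) (α : ℝ) {u : ℝ}
    (hu : u ∈ Set.Icc (0:ℝ) 1) (V B : Matrix N N ℂ) :
    2 * (gns B V).re - linearForm α u X B ≤ linearInvForm U l α V u := by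
  rw [h.linearForm_eq, h.re_gns_eq, linearInvForm, ← mul_div_assoc, ← sub_div]
  refine div_le_div_of_nonneg_right ?_ (Nat.cast_nonneg _)
  rw [Finset.mul_sum, ← Finset.sum_sub_distrib]
  refine Finset.sum_le_sum fun a _ => ?_
  rw [Finset.mul_sum, ← Finset.sum_sub_distrib]
  refine Finset.sum_le_sum fun b _ => ?_
  have hk := linearKernel_pos α hu (hl a) (hl b)
  set k := linearKernel α u (l a) (l b)
  set v := (Uᴴ * V * U) a b
  set g := (Uᴴ * B * U) a b
  have h1 : (star g * v).re ≤ ‖g‖ * ‖v‖ := by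
    refine (Complex.re_le_norm _).trans ?_
    rw [norm_mul, norm_star]
  have h2 : 0 ≤ (‖v‖ - k * ‖g‖) ^ 2 / k := by positivity
  have h3 : (‖v‖ - k * ‖g‖) ^ 2 / k = ‖v‖ ^ 2 * k⁻¹ + k * ‖g‖ ^ 2 - ‖g‖ * ‖v‖ * 2 := by
    field_simp
    ring
  linarith

lemma exists_two_mul_re_gns_sub_linearForm_eq (h : Diagonalizes U l X) (hl : ∀ i, 0 < l i) (α : ℝ)
    {u : ℝ} (hu : u ∈ Set.Icc (0:ℝ) 1) (V : Matrix N N ℂ) :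
    ∃ B, 2 * (gns B V).re - linearForm α u X B = linearInvForm U l α V u := by
  refine ⟨U * (Matrix.of fun a b => ((linearKernel α u (l a) (l b))⁻¹ : ℝ) * (Uᴴ * V * U) a b) * Uᴴ,
    ?_⟩
  rw [h.linearForm_eq, h.re_gns_eq, h.rotate_unrotate, linearInvForm, ← mul_div_assoc, ← sub_div]
  congr 1
  rw [Finset.mul_sum, ← Finset.sum_sub_distrib]
  refine Finset.sum_congr rfl fun a _ => ?_
  rw [Finset.mul_sum, ← Finset.sum_sub_distrib]
  refine Finset.sum_congr rfl fun b _ => ?_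
  have hk := linearKernel_pos α hu (hl a) (hl b)
  set k := linearKernel α u (l a) (l b)
  set v := (Uᴴ * V * U) a b
  have h1 : (star ((k⁻¹ : ℝ) * v) * v).re = k⁻¹ * ‖v‖ ^ 2 := by
    rw [star_mul', Complex.star_def, Complex.conj_ofReal, mul_assoc,
      Complex.re_ofReal_mul, Complex.conj_mul']
    norm_cast
  rw [Matrix.of_apply, h1, norm_mul, Complex.norm_real, Real.norm_of_nonneg (inv_pos.2 hk).le]
  field_simp
  ring

end Diagonalizes

/-- Joint convexity of `(X, V) ↦ ⟨V, [X]_α⁻¹ V⟩`. -/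
lemma invAction_combo_le {X Y : Matrix N N ℂ} (hX : X.PosDef) (hY : Y.PosDef) {a b : ℝ}
    (ha : 0 ≤ a) (hb : 0 ≤ b) (hZ : (a • X + b • Y).PosDef) (α : ℝ) (V W : Matrix N N ℂ) :
    invAction (a • X + b • Y) α (a • V + b • W) ≤ a * invAction X α V + b * invAction Y α W := by
  obtain ⟨U₁, l₁, h₁, hl₁, e₁⟩ := hX.exists_diagonalizes
  obtain ⟨U₂, l₂, h₂, hl₂, e₂⟩ := hY.exists_diagonalizes
  obtain ⟨U₃, l₃, h₃, hl₃, e₃⟩ := hZ.exists_diagonalizes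
  have i₁ := intervalIntegrable_linearInvForm U₁ hl₁ α V
  have i₂ := intervalIntegrable_linearInvForm U₂ hl₂ α W
  rw [e₁, e₂, e₃, ← integral_linearInvForm U₁ hl₁, ← integral_linearInvForm U₂ hl₂,
    ← integral_linearInvForm U₃ hl₃, ← intervalIntegral.integral_const_mul,
    ← intervalIntegral.integral_const_mul,
    ← intervalIntegral.integral_add (i₁.const_mul a) (i₂.const_mul b)]
  apply intervalIntegral.integral_mono_on zero_le_one
    (intervalIntegrable_linearInvForm U₃ hl₃ α _) ((i₁.const_mul a).add (i₂.const_mul b))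
  intro u hu
  obtain ⟨B, hB⟩ := h₃.exists_two_mul_re_gns_sub_linearForm_eq hl₃ α hu (a • V + b • W)
  rw [← hB, linearForm_combo, gns_add_right, gns_smul_right, gns_smul_right, Complex.add_re,
    Complex.re_ofReal_mul, Complex.re_ofReal_mul]
  have j₁ := mul_le_mul_of_nonneg_left (h₁.two_mul_re_gns_sub_linearForm_le hl₁ α hu V B) ha
  have j₂ := mul_le_mul_of_nonneg_left (h₂.two_mul_re_gns_sub_linearForm_le hl₂ α hu W B) hb
  linarith

end Convexity

section Total

variable {N : Type*} [Fintype N] [DecidableEq N] {J : Type*} [Fintype J]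

/-- The quadratic form `⟨V, [X]_ω⁻¹ V⟩` on `H`. -/
noncomputable def invActionH (ω : J → ℝ) (X : Matrix N N ℂ) (V : J → Matrix N N ℂ) : ℝ :=
  ∑ j, invAction X (ω j) (V j)

lemma gnsH_re (V W : J → Matrix N N ℂ) : (gnsH V W).re = ∑ j, (gns (V j) (W j)).re :=
  Complex.re_sum _ _

variable {X : Matrix N N ℂ}

lemma Matrix.PosDef.re_gnsH_opOmega (hX : X.PosDef) (ω : J → ℝ) (W : J → Matrix N N ℂ) :
    (gnsH W (opOmega ω X W)).re = invActionH ω X (opOmega ω X W) := by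
  rw [gnsH_re]
  exact Finset.sum_congr rfl fun j _ => hX.re_gns_sandwich_eq_invAction (ω j) (W j)

lemma Matrix.PosDef.invQuadH_eq (hX : X.PosDef) (ω : J → ℝ) (V : J → Matrix N N ℂ) :
    invQuadH (opOmega ω X) V = ENNReal.ofReal (invActionH ω X V) := by
  have hinj : ∀ W W' : J → Matrix N N ℂ, opOmega ω X W = opOmega ω X W' → W = W' :=
    fun W W' h => funext fun j => hX.sandwich_injective (ω j) (congr_fun h j)
  have hzero : opOmega ω X (0 : J → Matrix N N ℂ) = 0 := by
    ext j i k
    simp [opOmega, sandwich]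
  have h : ∃ W, opOmega ω X W = V ∧ ∀ U, opOmega ω X U = 0 → gnsH W U = 0 := by
    choose W hW using fun j => hX.sandwich_surjective (ω j) (V j)
    refine ⟨W, funext hW, fun U hU => ?_⟩
    rw [hinj U 0 (hU.trans hzero.symm)]
    simp [gnsH, gns, tau]
  rw [invQuadH, dif_pos h, hX.re_gnsH_opOmega, h.choose_spec.1]

lemma Matrix.PosDef.re_gnsH_le (hX : X.PosDef) (ω : J → ℝ) (V G : J → Matrix N N ℂ) :
    (gnsH V G).re ≤ invActionH ω X V / 2 + (gnsH G (opOmega ω X G)).re / 2 := by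
  rw [gnsH_re, gnsH_re, invActionH, Finset.sum_div, Finset.sum_div, ← Finset.sum_add_distrib]
  exact Finset.sum_le_sum fun j _ => hX.re_gns_le (ω j) (V j) (G j)

end Total

section Algebra

variable {N : Type*} [Fintype N] [DecidableEq N] {J : Type*} [Fintype J]

lemma eq_zero_of_re_gns_self {A : Matrix N N ℂ} (h : (gns A A).re = 0) : A = 0 := by
  ext i j
  have : Nonempty N := ⟨i⟩
  have hn : (Fintype.card N : ℝ) ≠ 0 := by exact_mod_cast Fintype.card_ne_zero
  rw [gns_self_re, div_eq_zero_iff, or_iff_left hn] at h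
  have h1 := (Finset.sum_eq_zero_iff_of_nonneg
    fun a _ => Finset.sum_nonneg fun b _ => sq_nonneg _).1 h i (Finset.mem_univ i)
  have h2 := (Finset.sum_eq_zero_iff_of_nonneg fun b _ => sq_nonneg _).1 h1 j (Finset.mem_univ j)
  simpa using h2

lemma gns_star (A B : Matrix N N ℂ) : star (gns A B) = gns B A := by
  rw [gns_eq_sum, gns_eq_sum, star_div₀]
  simp [mul_comm]

lemma gns_sub_left (A B C : Matrix N N ℂ) : gns (A - B) C = gns A C - gns B C := by
  simp only [gns, tau, conjTranspose_sub, Matrix.sub_mul, Matrix.trace_sub, sub_div]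

lemma gns_add_left (A B C : Matrix N N ℂ) : gns (A + B) C = gns A C + gns B C := by
  simp only [gns, tau, conjTranspose_add, Matrix.add_mul, Matrix.trace_add, add_div]

lemma gns_smul_left (r : ℝ) (A B : Matrix N N ℂ) : gns (r • A) B = r * gns A B := by
  simp only [gns, tau, conjTranspose_smul, star_trivial, Matrix.smul_mul, Matrix.trace_smul,
    Complex.real_smul, mul_div_assoc]

lemma gns_ext {A B : Matrix N N ℂ} (h : ∀ C, gns A C = gns B C) : A = B := by
  rw [← sub_eq_zero]
  apply eq_zero_of_re_gns_self
  rw [gns_sub_left, h, sub_self, Complex.zero_re]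

lemma gns_conjTranspose_left (A B : Matrix N N ℂ) : gns Aᴴ B = star (gns A Bᴴ) := by
  rw [gns_star, gns, gns, conjTranspose_conjTranspose, conjTranspose_conjTranspose, tau, tau,
    Matrix.trace_mul_comm]

lemma gns_one_right (A : Matrix N N ℂ) : gns A 1 = star (tau A) := by
  rw [gns, Matrix.mul_one, tau, tau, trace_conjTranspose, star_div₀]
  simp

lemma tau_mul_of_isHermitian {A : Matrix N N ℂ} (hA : A.IsHermitian) (B : Matrix N N ℂ) :
    tau (A * B) = gns A B := by
  rw [gns, hA.eq]

lemma tau_mul_comm (A B : Matrix N N ℂ) : tau (A * B) = tau (B * A) := by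
  rw [tau, Matrix.trace_mul_comm, tau]

lemma tau_add (A B : Matrix N N ℂ) : tau (A + B) = tau A + tau B := by
  simp only [tau, Matrix.trace_add, add_div]

lemma tau_smul (r : ℝ) (A : Matrix N N ℂ) : tau (r • A) = r * tau A := by
  simp only [tau, Matrix.trace_smul, Complex.real_smul, mul_div_assoc]

lemma tau_one [Nonempty N] : tau (1 : Matrix N N ℂ) = 1 := by
  rw [tau, Matrix.trace_one, div_self]
  exact_mod_cast Fintype.card_ne_zero

lemma dvg_eq {Vf : J → Matrix N N ℂ} {dvg : (J → Matrix N N ℂ) → Matrix N N ℂ}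
    (hdvg : ∀ (W : J → Matrix N N ℂ) (B : Matrix N N ℂ),
      gns (dvg W) B = -∑ j, gns (W j) (Vf j * B - B * Vf j)) (W : J → Matrix N N ℂ) :
    dvg W = ∑ j, (W j * (Vf j)ᴴ - (Vf j)ᴴ * W j) := by
  apply gns_ext
  intro B
  have hsum : gns (∑ j, (W j * (Vf j)ᴴ - (Vf j)ᴴ * W j)) B =
      ∑ j, gns (W j * (Vf j)ᴴ - (Vf j)ᴴ * W j) B := by
    simp only [gns, tau, conjTranspose_sum, Finset.sum_mul, Matrix.trace_sum, Finset.sum_div]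
  rw [hdvg, hsum, ← Finset.sum_neg_distrib]
  refine Finset.sum_congr rfl fun j _ => ?_
  have h1 : ((W j)ᴴ * B * Vf j).trace = (Vf j * (W j)ᴴ * B).trace := by
    rw [Matrix.trace_mul_comm, ← Matrix.mul_assoc]
  simp only [gns, tau, conjTranspose_sub, conjTranspose_mul, conjTranspose_conjTranspose,
    Matrix.sub_mul, Matrix.mul_sub, Matrix.trace_sub, ← Matrix.mul_assoc, h1]
  ring

lemma genL_conjTranspose {st : J → J} {Vf : J → Matrix N N ℂ} {ω : J → ℝ}
    (hstinv : ∀ j, st (st j) = j) (hVst : ∀ j, Vf (st j) = (Vf j)ᴴ) (hωst : ∀ j, ω (st j) = -ω j)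
    (B : Matrix N N ℂ) : genL Vf ω Bᴴ = (genL Vf ω B)ᴴ := by
  rw [genL, genL, conjTranspose_sum]
  have hst : Function.Involutive st := hstinv
  rw [← Equiv.sum_comp hst.toPerm]
  refine Finset.sum_congr rfl fun j _ => ?_
  simp only [Function.Involutive.coe_toPerm, hVst, hωst, neg_neg, conjTranspose_conjTranspose,
    conjTranspose_sub, conjTranspose_smul, conjTranspose_mul, star_trivial, Matrix.mul_sub,
    Matrix.sub_mul, smul_sub]
  abel

lemma genL_one (Vf : J → Matrix N N ℂ) (ω : J → ℝ) : genL Vf ω 1 = 0 := by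
  simp [genL]

lemma genL_eq_zero_of_gradD {Vf : J → Matrix N N ℂ} (ω : J → ℝ) {A : Matrix N N ℂ}
    (h : gradD Vf A = 0) : genL Vf ω A = 0 := by
  rw [genL]
  refine Finset.sum_eq_zero fun j _ => ?_
  have h1 : Vf j * A = A * Vf j := sub_eq_zero.1 (congr_fun h j)
  simp [h1]

lemma Matrix.IsHermitian.gradD_symm {st : J → J} {Vf : J → Matrix N N ℂ}
    (hVst : ∀ j, Vf (st j) = (Vf j)ᴴ) {A : Matrix N N ℂ} (hA : A.IsHermitian) (j : J) :
    gradD Vf A (st j) = -(gradD Vf A j)ᴴ := by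
  simp only [gradD, hVst, conjTranspose_sub, conjTranspose_mul, hA.eq]
  abel

lemma sandwich_neg (X : Matrix N N ℂ) (α : ℝ) (A : Matrix N N ℂ) :
    sandwich X α (-A) = -sandwich X α A := by
  ext i k
  simp [sandwich]

lemma Matrix.PosSemidef.opOmega_symm {st : J → J} {ω : J → ℝ} (hωst : ∀ j, ω (st j) = -ω j)
    {X : Matrix N N ℂ} (hX : X.PosSemidef) {W : J → Matrix N N ℂ} (hW : ∀ j, W (st j) = -(W j)ᴴ)
    (j : J) : opOmega ω X W (st j) = -(opOmega ω X W j)ᴴ := by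
  rw [opOmega, opOmega, hW, hωst, sandwich_neg, hX.sandwich_conjTranspose]

section Adjoint

variable {Vf : J → Matrix N N ℂ} {ω : J → ℝ} {Ldag : Matrix N N ℂ → Matrix N N ℂ}

lemma Ldag_add (hLdag : ∀ ρ B : Matrix N N ℂ, gns (Ldag ρ) B = gns ρ (genL Vf ω B))
    (ρ ρ' : Matrix N N ℂ) : Ldag (ρ + ρ') = Ldag ρ + Ldag ρ' :=
  gns_ext fun C => by rw [hLdag, gns_add_left, gns_add_left, hLdag, hLdag]

lemma Ldag_smul (hLdag : ∀ ρ B : Matrix N N ℂ, gns (Ldag ρ) B = gns ρ (genL Vf ω B))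
    (r : ℝ) (ρ : Matrix N N ℂ) : Ldag (r • ρ) = r • Ldag ρ :=
  gns_ext fun C => by rw [hLdag, gns_smul_left, gns_smul_left, hLdag]

lemma tau_Ldag (hLdag : ∀ ρ B : Matrix N N ℂ, gns (Ldag ρ) B = gns ρ (genL Vf ω B))
    (ρ : Matrix N N ℂ) : tau (Ldag ρ) = 0 := by
  have := hLdag ρ 1
  rw [gns_one_right, genL_one] at this
  rw [← star_eq_zero, this]
  simp [gns, tau]

lemma isHermitian_Ldag {st : J → J}
    (hstinv : ∀ j, st (st j) = j) (hVst : ∀ j, Vf (st j) = (Vf j)ᴴ) (hωst : ∀ j, ω (st j) = -ω j)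
    (hLdag : ∀ ρ B : Matrix N N ℂ, gns (Ldag ρ) B = gns ρ (genL Vf ω B))
    {ρ : Matrix N N ℂ} (hρ : ρ.IsHermitian) : (Ldag ρ).IsHermitian := by
  refine gns_ext fun C => ?_
  rw [gns_conjTranspose_left, hLdag, hLdag, genL_conjTranspose hstinv hVst hωst,
    ← gns_conjTranspose_left, hρ.eq]

variable {dvg : (J → Matrix N N ℂ) → Matrix N N ℂ}

lemma tau_dvg (hdvg : ∀ (W : J → Matrix N N ℂ) (B : Matrix N N ℂ),
      gns (dvg W) B = -∑ j, gns (W j) (Vf j * B - B * Vf j)) (W : J → Matrix N N ℂ) :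
    tau (dvg W) = 0 := by
  have := hdvg W 1
  rw [gns_one_right] at this
  rw [← star_eq_zero, this]
  simp [gns, tau]

lemma isHermitian_dvg {st : J → J}
    (hstinv : ∀ j, st (st j) = j) (hVst : ∀ j, Vf (st j) = (Vf j)ᴴ)
    (hdvg : ∀ (W : J → Matrix N N ℂ) (B : Matrix N N ℂ),
      gns (dvg W) B = -∑ j, gns (W j) (Vf j * B - B * Vf j))
    {W : J → Matrix N N ℂ} (hW : ∀ j, W (st j) = -(W j)ᴴ) : (dvg W).IsHermitian := by
  have hst : Function.Involutive st := hstinv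
  rw [Matrix.IsHermitian, dvg_eq hdvg, conjTranspose_sum]
  conv_rhs => rw [← Equiv.sum_comp hst.toPerm]
  refine Finset.sum_congr rfl fun j _ => ?_
  simp only [Function.Involutive.coe_toPerm, hVst, hW, conjTranspose_conjTranspose,
    conjTranspose_sub, conjTranspose_mul, Matrix.neg_mul, Matrix.mul_neg]
  abel

/-- The time derivative of `τ(A ρ)` in direction of the continuity equation. -/
lemma re_tau_mul_drift (hdvg : ∀ (W : J → Matrix N N ℂ) (B : Matrix N N ℂ),
      gns (dvg W) B = -∑ j, gns (W j) (Vf j * B - B * Vf j))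
    (hLdag : ∀ ρ B : Matrix N N ℂ, gns (Ldag ρ) B = gns ρ (genL Vf ω B))
    {A ρ : Matrix N N ℂ} (hA : A.IsHermitian) (hρ : ρ.IsHermitian) (ε : ℝ)
    (W : J → Matrix N N ℂ) :
    (tau (A * (ε • Ldag ρ - dvg W))).re =
      ε * (tau (genL Vf ω A * ρ)).re + (gnsH W (gradD Vf A)).re := by
  have h : star (tau (A * (ε • Ldag ρ - dvg W))) =
      ε * tau (genL Vf ω A * ρ) + gnsH W (gradD Vf A) := by
    rw [tau_mul_of_isHermitian hA, gns_star, gns_sub_left, gns_smul_left, hLdag, hdvg,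
      sub_neg_eq_add, ← tau_mul_of_isHermitian hρ, tau_mul_comm]
    rfl
  have h2 := congr_arg Complex.re h
  rwa [Complex.star_def, Complex.conj_re, Complex.add_re, Complex.re_ofReal_mul] at h2

end Adjoint

end Algebra

lemma ofReal_integral_le_lintegral_ofReal {f : ℝ → ℝ} (hf : IntervalIntegrable f volume 0 1) :
    ENNReal.ofReal (∫ t in (0:ℝ)..1, f t) ≤ ∫⁻ t in Set.Icc (0:ℝ) 1, ENNReal.ofReal (f t) := by
  rw [intervalIntegrable_iff_integrableOn_Icc_of_le zero_le_one] at hf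
  rw [intervalIntegral.integral_of_le zero_le_one, ← integral_Icc_eq_integral_Ioc]
  have h1 : ∫ t in Set.Icc (0:ℝ) 1, f t ≤ ∫ t in Set.Icc (0:ℝ) 1, max (f t) 0 :=
    integral_mono hf hf.pos_part fun t => le_max_left _ _
  refine (ENNReal.ofReal_le_ofReal h1).trans ?_
  rw [ofReal_integral_eq_lintegral_ofReal hf.pos_part
    (Filter.Eventually.of_forall fun t => le_max_right _ _)]
  refine lintegral_mono fun t => ?_
  rw [ENNReal.ofReal_max, ENNReal.ofReal_zero, max_eq_left zero_le]

section Weak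

variable {N : Type*} [Fintype N] [DecidableEq N] {J : Type*} [Fintype J]

lemma re_tau_mul (A B : Matrix N N ℂ) :
    (tau (A * B)).re = (∑ i, ∑ k, A i k * B k i).re / Fintype.card N := by
  rw [tau, Complex.div_natCast_re, Matrix.trace]
  rfl

lemma hasDerivAt_re_tau_mul {A A' ρ ρ' : ℝ → Matrix N N ℂ} {t : ℝ}
    (hA : ∀ i k, HasDerivAt (fun s => A s i k) (A' t i k) t)
    (hρ : ∀ i k, HasDerivAt (fun s => ρ s i k) (ρ' t i k) t) :
    HasDerivAt (fun s => (tau (A s * ρ s)).re)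
      ((tau (A' t * ρ t)).re + (tau (A t * ρ' t)).re) t := by
  simp only [re_tau_mul]
  have h1 : HasDerivAt (fun s => ∑ i, ∑ k, A s i k * ρ s k i)
      (∑ i, ∑ k, (A' t i k * ρ t k i + A t i k * ρ' t k i)) t :=
    HasDerivAt.fun_sum fun i _ => HasDerivAt.fun_sum fun k _ => (hA i k).mul (hρ k i)
  have h2 : HasDerivAt (fun s => (∑ i, ∑ k, A s i k * ρ s k i).re)
      (∑ i, ∑ k, (A' t i k * ρ t k i + A t i k * ρ' t k i)).re t :=
    Complex.reCLM.hasFDerivAt.comp_hasDerivAt t h1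
  rw [← add_div, ← Complex.add_re, ← Finset.sum_add_distrib]
  simp only [← Finset.sum_add_distrib]
  exact h2.div_const (Fintype.card N : ℝ)

lemma continuousOn_re_tau_mul {A ρ : ℝ → Matrix N N ℂ} {S : Set ℝ}
    (hA : ∀ i k, ContinuousOn (fun s => A s i k) S) (hρ : ∀ i k, ContinuousOn (fun s => ρ s i k) S) :
    ContinuousOn (fun s => (tau (A s * ρ s)).re) S := by
  simp only [re_tau_mul]
  refine ContinuousOn.div_const (Complex.continuous_re.comp_continuousOn ?_) _
  exact continuousOn_finsetSum _ fun i _ => continuousOn_finsetSum _ fun k _ => (hA i k).mul (hρ k i)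

/-- **Weak duality.** -/
lemma IsHJB.ofReal_le {Vf : J → Matrix N N ℂ} {ω : J → ℝ} {ε : ℝ}
    {dvg : (J → Matrix N N ℂ) → Matrix N N ℂ} {Ldag : Matrix N N ℂ → Matrix N N ℂ}
    (hdvg : ∀ (W : J → Matrix N N ℂ) (B : Matrix N N ℂ),
      gns (dvg W) B = -∑ j, gns (W j) (Vf j * B - B * Vf j))
    (hLdag : ∀ ρ B : Matrix N N ℂ, gns (Ldag ρ) B = gns ρ (genL Vf ω B))
    {A A' : ℝ → Matrix N N ℂ} (hA : IsHJB Vf ω ε A A') {ρ₀ ρ₁ : Matrix N N ℂ}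
    {ρ : ℝ → Matrix N N ℂ} {V : ℝ → J → Matrix N N ℂ} (hρ : IsCE dvg Ldag ε ρ₀ ρ₁ ρ V) :
    ENNReal.ofReal (tau (A 1 * ρ₁ - A 0 * ρ₀)).re * 2 ≤
      ∫⁻ t in Set.Icc (0:ℝ) 1, invQuadH (opOmega ω (ρ t)) (V t) := by
  obtain ⟨hherm, hAd, hA'c, hHJ⟩ := hA
  obtain ⟨rfl, rfl, hpos, -, ρ', hρd, hρ'c, hce⟩ := hρ
  have hAc : ∀ i k, ContinuousOn (fun s => A s i k) (Set.Icc (0:ℝ) 1) := fun i k s hs =>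
    (hAd s hs i k).continuousAt.continuousWithinAt
  have hρc : ∀ i k, ContinuousOn (fun s => ρ s i k) (Set.Icc (0:ℝ) 1) := fun i k s hs =>
    (hρd s hs i k).continuousAt.continuousWithinAt
  set f' : ℝ → ℝ := fun t => (tau (A' t * ρ t)).re + (tau (A t * ρ' t)).re with hf'
  have hf'i : IntervalIntegrable f' volume 0 1 := by
    apply ContinuousOn.intervalIntegrable
    rw [Set.uIcc_of_le zero_le_one]
    exact (continuousOn_re_tau_mul hA'c hρc).add (continuousOn_re_tau_mul hAc hρ'c)
  have hftc : ∫ t in (0:ℝ)..1, f' t = (tau (A 1 * ρ 1 - A 0 * ρ 0)).re := by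
    rw [intervalIntegral.integral_eq_sub_of_hasDerivAt (f := fun t => (tau (A t * ρ t)).re) _ hf'i]
    · simp only [tau, Matrix.trace_sub, sub_div, Complex.sub_re]
    · intro t ht
      rw [Set.uIcc_of_le zero_le_one] at ht
      exact hasDerivAt_re_tau_mul (hAd t ht) (hρd t ht)
  have h2 : ENNReal.ofReal (tau (A 1 * ρ 1 - A 0 * ρ 0)).re * 2 =
      ENNReal.ofReal (∫ t in (0:ℝ)..1, 2 * f' t) := by
    rw [intervalIntegral.integral_const_mul, hftc, mul_comm 2 (Complex.re _),
      ENNReal.ofReal_mul' zero_le_two]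
    norm_num
  rw [h2]
  refine (ofReal_integral_le_lintegral_ofReal (hf'i.const_mul 2)).trans ?_
  refine setLIntegral_mono' measurableSet_Icc fun t ht => ?_
  obtain ⟨hpd, htr⟩ := hpos t ht
  rw [hpd.invQuadH_eq]
  refine ENNReal.ofReal_le_ofReal ?_
  have h3 : ρ' t = ε • Ldag (ρ t) - dvg (V t) := eq_sub_of_add_eq (hce t ht)
  have h4 := hHJ t ht (ρ t) hpd.posSemidef htr
  rw [Matrix.add_mul, tau_add, Complex.add_re, Matrix.smul_mul, tau_smul,
    Complex.re_ofReal_mul] at h4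
  have h5 := hpd.re_gnsH_le ω (V t) (gradD Vf (A t))
  simp only [hf']
  rw [h3, re_tau_mul_drift hdvg hLdag (hherm t ht) hpd.1]
  linarith

end Weak

section Instantiation

attribute [local instance] Matrix.normedAddCommGroup Matrix.normedSpace

variable {N : Type*} [Fintype N] [DecidableEq N] {J : Type*} [Fintype J]

/-- Hermitian matrices of trace zero, the tangent space of the density matrices. -/
def StateSpace (N : Type*) [Fintype N] : Submodule ℝ (Matrix N N ℂ) where
  carrier := {B | B.IsHermitian ∧ tau B = 0}
  add_mem' := fun {A B} hA hB => ⟨hA.1.add hB.1, by rw [tau_add, hA.2, hB.2, add_zero]⟩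
  zero_mem' := ⟨Matrix.isHermitian_zero, by simp [tau]⟩
  smul_mem' := fun r A hA => ⟨by
    rw [Matrix.IsHermitian, conjTranspose_smul, hA.1.eq, star_trivial],
    by rw [tau_smul, hA.2, mul_zero]⟩

/-- Vector fields with the symmetry of gradients of hermitian matrices. -/
def FluxSpace (N : Type*) [Fintype N] (st : J → J) : Submodule ℝ (J → Matrix N N ℂ) where
  carrier := {V | ∀ j, V (st j) = -(V j)ᴴ}
  add_mem' := fun {V W} hV hW j => by
    rw [Pi.add_apply, hV, hW, Pi.add_apply, conjTranspose_add, neg_add]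
  zero_mem' := fun j => by simp
  smul_mem' := fun r V hV j => by
    rw [Pi.smul_apply, hV, Pi.smul_apply, conjTranspose_smul, star_trivial, smul_neg]

instance : FiniteDimensional ℝ (Matrix N N ℂ) := inferInstanceAs (FiniteDimensional ℝ (N → N → ℂ))

lemma re_dotProduct_pos_of_isHermitian {X : Matrix N N ℂ} (hX : X.IsHermitian) :
    X.PosDef ↔ ∀ v ∈ Metric.sphere (0 : N → ℂ) 1, 0 < (star v ⬝ᵥ (X *ᵥ v)).re := by
  rw [Matrix.posDef_iff_dotProduct_mulVec]
  constructor
  · rintro ⟨-, h⟩ v hv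
    have hv0 : v ≠ 0 := by
      rintro rfl
      simp at hv
    exact (Complex.lt_def.1 (h hv0)).1
  · intro h
    refine ⟨hX, fun v hv => ?_⟩
    have hn : 0 < ‖v‖ := norm_pos_iff.2 hv
    have him : (star v ⬝ᵥ (X *ᵥ v)).im = 0 := by
      simpa using hX.im_star_dotProduct_mulVec_self v
    have h1 := h (‖v‖⁻¹ • v) (by simp [norm_smul, hn.ne'])
    rw [star_smul, star_trivial, Matrix.mulVec_smul, smul_dotProduct, dotProduct_smul, smul_smul,
      Complex.real_smul, Complex.re_ofReal_mul] at h1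
    rw [Complex.lt_def]
    exact ⟨(mul_pos_iff_of_pos_left (by positivity)).1 h1, him.symm⟩

lemma isHermitian_one_add (x : StateSpace N) : (1 + (x : Matrix N N ℂ)).IsHermitian :=
  Matrix.isHermitian_one.add x.2.1

lemma tau_one_add [Nonempty N] (x : StateSpace N) : tau (1 + (x : Matrix N N ℂ)) = 1 := by
  rw [tau_add, tau_one, x.2.2, add_zero]

lemma isOpen_posDef_one_add : IsOpen {x : StateSpace N | (1 + (x : Matrix N N ℂ)).PosDef} := by
  rw [isOpen_iff_eventually]
  intro x hx
  rw [Set.mem_ofPred_eq, re_dotProduct_pos_of_isHermitian (isHermitian_one_add x)] at hx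
  have := IsCompact.eventually_forall_of_forall_eventually (x₀ := x)
    (P := fun (y : StateSpace N) (v : N → ℂ) =>
      0 < (star v ⬝ᵥ ((1 + (y : Matrix N N ℂ)) *ᵥ v)).re)
    (isCompact_sphere (0 : N → ℂ) 1) (fun v hv => ?_)
  · filter_upwards [this] with y hy
    exact (re_dotProduct_pos_of_isHermitian (isHermitian_one_add y)).2 hy
  · refine ContinuousAt.eventually_lt (f := fun _ => (0:ℝ)) continuousAt_const ?_ (hx v hv)
    refine Continuous.continuousAt (Complex.continuous_re.comp ?_)
    refine Continuous.dotProduct (by fun_prop) (Continuous.matrix_mulVec ?_ (by fun_prop))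
    exact continuous_const.add (continuous_subtype_val.comp continuous_fst)

lemma Matrix.PosDef.norm_apply_le [Nonempty N] {X : Matrix N N ℂ} (hX : X.PosDef) (ht : tau X = 1)
    (i j : N) : ‖X i j‖ ≤ Fintype.card N * Fintype.card N := by
  obtain ⟨U, l, h, hl, -⟩ := hX.exists_diagonalizes
  have hU : U ∈ Matrix.unitaryGroup N ℂ := (Matrix.mem_unitaryGroup_iff).2 h.right
  rw [h.eq, Matrix.mul_apply]
  refine (norm_sum_le_of_le _ (f := _) (n := fun _ => (Fintype.card N : ℝ)) fun a _ => ?_).trans ?_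
  · rw [Matrix.mul_diagonal, norm_mul, norm_mul, conjTranspose_apply, norm_star, Complex.norm_real,
      Real.norm_of_nonneg (hl a).le]
    have h1 := entry_norm_bound_of_unitary hU i a
    have h2 := entry_norm_bound_of_unitary hU j a
    have h3 := h.eigenvalue_le (fun i => (hl i).le) ht a
    calc ‖U i a‖ * l a * ‖U j a‖ ≤ 1 * l a * 1 := by
          have := (hl a).le
          gcongr
      _ ≤ _ := by simpa using h3
  · simp

lemma isBounded_posDef_one_add [Nonempty N] :
    Bornology.IsBounded {x : StateSpace N | (1 + (x : Matrix N N ℂ)).PosDef} := by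
  rw [isBounded_iff_forall_norm_le]
  refine ⟨Fintype.card N * Fintype.card N + ‖(1 : Matrix N N ℂ)‖, fun x hx => ?_⟩
  have h1 : ‖1 + (x : Matrix N N ℂ)‖ ≤ Fintype.card N * Fintype.card N :=
    (Matrix.norm_le_iff (by positivity)).2 fun i j => hx.norm_apply_le (tau_one_add x) i j
  have h2 : (x : Matrix N N ℂ) = (1 + x) - 1 := by abel
  rw [Submodule.coe_norm, h2]
  exact (norm_sub_le _ _).trans (by gcongr)

lemma posDef_combo {X Y : Matrix N N ℂ} (hX : X.PosDef) (hY : Y.PosDef) {a b : ℝ}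
    (ha : 0 ≤ a) (hb : 0 ≤ b) (hab : a + b = 1) : (a • X + b • Y).PosDef := by
  rcases eq_or_lt_of_le ha with h | h
  · rw [← h, show b = 1 by linarith]
    simpa using hY
  · exact (hX.smul h).add_posSemidef (hY.posSemidef.smul hb)

lemma Matrix.PosDef.le_invActionH [Nonempty N] {X : Matrix N N ℂ} (hX : X.PosDef) (ht : tau X = 1)
    (ω : J → ℝ) (V : J → Matrix N N ℂ) :
    ‖V‖ ^ 2 / (Fintype.card N * (∑ j, Real.exp |ω j| + 1) * Fintype.card N) ≤
      invActionH ω X V := by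
  have hn : (0:ℝ) < Fintype.card N := by exact_mod_cast Fintype.card_pos
  have hM : 0 < ∑ j, Real.exp |ω j| + 1 := by positivity
  have h0 : 0 ≤ invActionH ω X V := Finset.sum_nonneg fun j _ => hX.invAction_nonneg (ω j) (V j)
  rw [div_le_iff₀ (by positivity)]
  have key : ∀ j i k, ‖V j i k‖ ^ 2 ≤
      invActionH ω X V * (Fintype.card N * (∑ j, Real.exp |ω j| + 1) * Fintype.card N) := by
    intro j i k
    have h1 := hX.le_invAction ht (ω j) (V j) i k
    have h2 : invAction X (ω j) (V j) ≤ invActionH ω X V :=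
      Finset.single_le_sum (f := fun j => invAction X (ω j) (V j))
        (fun j _ => hX.invAction_nonneg (ω j) (V j)) (Finset.mem_univ j)
    have h3 : Real.exp |ω j| ≤ ∑ j, Real.exp |ω j| + 1 := by
      have := Finset.single_le_sum (f := fun j => Real.exp |ω j|)
        (fun j _ => (Real.exp_pos _).le) (Finset.mem_univ j)
      linarith
    have h4 := h1.trans h2
    rw [div_le_iff₀ (by positivity)] at h4
    refine h4.trans ?_
    gcongr
  have hs : ‖V‖ ≤ Real.sqrt
      (invActionH ω X V * (Fintype.card N * (∑ j, Real.exp |ω j| + 1) * Fintype.card N)) := by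
    refine (pi_norm_le_iff_of_nonneg (Real.sqrt_nonneg _)).2 fun j =>
      (Matrix.norm_le_iff (Real.sqrt_nonneg _)).2 fun i k => ?_
    exact Real.le_sqrt_of_sq_le (key j i k)
  calc ‖V‖ ^ 2 ≤ _ := pow_le_pow_left₀ (norm_nonneg _) hs 2
    _ = _ := Real.sq_sqrt (by positivity)

end Instantiation

section TransportInstance

attribute [local instance] Matrix.normedAddCommGroup Matrix.normedSpace

variable {N : Type*} [Fintype N] [DecidableEq N] {J : Type*} [Fintype J]

lemma gradD_add (Vf : J → Matrix N N ℂ) (A B : Matrix N N ℂ) :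
    gradD Vf (A + B) = gradD Vf A + gradD Vf B := by
  ext1 j
  simp only [gradD, Pi.add_apply, Matrix.mul_add, Matrix.add_mul]
  abel

lemma gradD_smul (Vf : J → Matrix N N ℂ) (r : ℝ) (A : Matrix N N ℂ) :
    gradD Vf (r • A) = r • gradD Vf A := by
  ext1 j
  simp only [gradD, Pi.smul_apply, Matrix.mul_smul, Matrix.smul_mul, smul_sub]

lemma gradD_one (Vf : J → Matrix N N ℂ) : gradD Vf 1 = 0 := by
  ext1 j
  simp [gradD]

section Operators

variable {st : J → J} {Vf : J → Matrix N N ℂ} {ω : J → ℝ} {ε : ℝ}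
  {dvg : (J → Matrix N N ℂ) → Matrix N N ℂ} {Ldag : Matrix N N ℂ → Matrix N N ℂ}

lemma dvg_add (hdvg : ∀ (W : J → Matrix N N ℂ) (B : Matrix N N ℂ),
      gns (dvg W) B = -∑ j, gns (W j) (Vf j * B - B * Vf j)) (V W : J → Matrix N N ℂ) :
    dvg (V + W) = dvg V + dvg W :=
  gns_ext fun C => by
    rw [gns_add_left, hdvg, hdvg, hdvg, ← neg_add, ← Finset.sum_add_distrib]
    simp only [Pi.add_apply, gns_add_left]

lemma dvg_smul (hdvg : ∀ (W : J → Matrix N N ℂ) (B : Matrix N N ℂ),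
      gns (dvg W) B = -∑ j, gns (W j) (Vf j * B - B * Vf j)) (r : ℝ) (W : J → Matrix N N ℂ) :
    dvg (r • W) = r • dvg W :=
  gns_ext fun C => by
    rw [gns_smul_left, hdvg, hdvg, mul_neg, Finset.mul_sum]
    simp only [Pi.smul_apply, gns_smul_left]

/-- On trace-free hermitian matrices, ergodicity makes the kernel of the gradient trivial. -/
lemma eq_zero_of_dvg_gradD_eq_zero [Nonempty N]
    (hdvg : ∀ (W : J → Matrix N N ℂ) (B : Matrix N N ℂ),
      gns (dvg W) B = -∑ j, gns (W j) (Vf j * B - B * Vf j))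
    (herg : ∀ A : Matrix N N ℂ, genL Vf ω A = 0 → ∃ c : ℂ, A = c • (1 : Matrix N N ℂ))
    {A : Matrix N N ℂ} (ht : tau A = 0) (h : dvg (gradD Vf A) = 0) : A = 0 := by
  have h1 := hdvg (gradD Vf A) A
  rw [h, show gns (0 : Matrix N N ℂ) A = 0 by simp [gns, tau], eq_comm, neg_eq_zero] at h1
  have h2 : ∑ j, (gns (gradD Vf A j) (gradD Vf A j)).re = 0 := by
    rw [← Complex.re_sum]
    exact (congrArg Complex.re h1).trans Complex.zero_re
  have h3 : gradD Vf A = 0 := funext fun j => eq_zero_of_re_gns_self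
    ((Finset.sum_eq_zero_iff_of_nonneg fun j _ => by
      rw [gns_self_re]; positivity).1 h2 j (Finset.mem_univ j))
  obtain ⟨c, hc⟩ := herg A (genL_eq_zero_of_gradD ω h3)
  have h4 : tau A = c := by
    rw [hc, tau, Matrix.trace_smul, smul_eq_mul, mul_div_assoc]
    exact (congrArg (c * ·) tau_one).trans (mul_one c)
  rw [hc, ← h4, ht, zero_smul]

/-- The divergence as a map from fluxes to states. -/
noncomputable def dvgLin (hstinv : ∀ j, st (st j) = j) (hVst : ∀ j, Vf (st j) = (Vf j)ᴴ)
    (hdvg : ∀ (W : J → Matrix N N ℂ) (B : Matrix N N ℂ),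
      gns (dvg W) B = -∑ j, gns (W j) (Vf j * B - B * Vf j)) :
    FluxSpace N st →ₗ[ℝ] StateSpace N where
  toFun V := ⟨dvg V, isHermitian_dvg hstinv hVst hdvg V.2, tau_dvg hdvg V⟩
  map_add' V W := Subtype.ext (dvg_add hdvg V W)
  map_smul' r V := Subtype.ext (dvg_smul hdvg r V)

/-- The gradient as a map from states to fluxes. -/
noncomputable def gradLin (hVst : ∀ j, Vf (st j) = (Vf j)ᴴ) :
    StateSpace N →ₗ[ℝ] FluxSpace N st where
  toFun A := ⟨gradD Vf A, A.2.1.gradD_symm hVst⟩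
  map_add' A B := Subtype.ext (gradD_add Vf A B)
  map_smul' r A := Subtype.ext (gradD_smul Vf r A)

/-- The adjoint generator on trace-free hermitian matrices. -/
noncomputable def LdagLin (ε : ℝ) (hstinv : ∀ j, st (st j) = j) (hVst : ∀ j, Vf (st j) = (Vf j)ᴴ)
    (hωst : ∀ j, ω (st j) = -ω j)
    (hLdag : ∀ ρ B : Matrix N N ℂ, gns (Ldag ρ) B = gns ρ (genL Vf ω B)) :
    StateSpace N →ₗ[ℝ] StateSpace N where
  toFun x := ε • ⟨Ldag x, isHermitian_Ldag hstinv hVst hωst hLdag x.2.1, tau_Ldag hLdag x⟩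
  map_add' x y := Subtype.ext <| by
    simp only [Submodule.coe_add, Submodule.coe_smul, Ldag_add hLdag, smul_add]
  map_smul' r x := Subtype.ext <| by
    simp only [Submodule.coe_smul, Ldag_smul hLdag, RingHom.id_apply]
    rw [smul_comm]

lemma surjective_dvgLin [Nonempty N] (hstinv : ∀ j, st (st j) = j)
    (hVst : ∀ j, Vf (st j) = (Vf j)ᴴ)
    (hdvg : ∀ (W : J → Matrix N N ℂ) (B : Matrix N N ℂ),
      gns (dvg W) B = -∑ j, gns (W j) (Vf j * B - B * Vf j))
    (herg : ∀ A : Matrix N N ℂ, genL Vf ω A = 0 → ∃ c : ℂ, A = c • (1 : Matrix N N ℂ)) :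
    Function.Surjective (dvgLin hstinv hVst hdvg) := by
  have hinj : Function.Injective (dvgLin hstinv hVst hdvg ∘ₗ gradLin hVst) := by
    rw [injective_iff_map_eq_zero]
    intro A hA
    exact Subtype.ext (eq_zero_of_dvg_gradD_eq_zero hdvg herg A.2.2 (congrArg Subtype.val hA))
  exact Function.Surjective.of_comp (g := gradLin hVst) (LinearMap.injective_iff_surjective.1 hinj)

lemma one_add_combo (x y : StateSpace N) {a b : ℝ} (hab : a + b = 1) :
    1 + ((a • x + b • y : StateSpace N) : Matrix N N ℂ) =
      a • (1 + (x : Matrix N N ℂ)) + b • (1 + (y : Matrix N N ℂ)) := by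
  have h1 : (1 : Matrix N N ℂ) = a • 1 + b • 1 := by rw [← add_smul, hab, one_smul]
  simp only [Submodule.coe_add, Submodule.coe_smul, smul_add]
  conv_lhs => rw [h1]
  abel

lemma invActionH_combo_le {X Y : Matrix N N ℂ} (hX : X.PosDef) (hY : Y.PosDef) {a b : ℝ}
    (ha : 0 ≤ a) (hb : 0 ≤ b) (hab : a + b = 1) (ω : J → ℝ) (V W : J → Matrix N N ℂ) :
    invActionH ω (a • X + b • Y) (a • V + b • W) ≤ a * invActionH ω X V + b * invActionH ω Y W := by
  simp only [invActionH, Finset.mul_sum, ← Finset.sum_add_distrib]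
  exact Finset.sum_le_sum fun j _ => invAction_combo_le hX hY ha hb
    (posDef_combo hX hY ha hb hab) (ω j) _ _

lemma Matrix.PosDef.invActionH_smul {X : Matrix N N ℂ} (hX : X.PosDef) (ω : J → ℝ) (r : ℝ)
    (V : J → Matrix N N ℂ) : invActionH ω X (r • V) = r ^ 2 * invActionH ω X V := by
  simp only [invActionH, Finset.mul_sum]
  exact Finset.sum_congr rfl fun j _ => hX.invAction_smul (ω j) r _

lemma convexOn_invActionH (st : J → J) (ω : J → ℝ) :
    ConvexOn ℝ ({x : StateSpace N | (1 + (x : Matrix N N ℂ)).PosDef} ×ˢ Set.univ)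
      (fun p : StateSpace N × FluxSpace N st =>
        invActionH ω (1 + (p.1 : Matrix N N ℂ)) (p.2 : J → Matrix N N ℂ) / 2) := by
  constructor
  · refine Convex.prod (fun x hx y hy a b ha hb hab => ?_) convex_univ
    rw [Set.mem_ofPred_eq, one_add_combo x y hab]
    exact posDef_combo hx hy ha hb hab
  · intro p hp p' hp' a b ha hb hab
    have h := invActionH_combo_le hp.1 hp'.1 ha hb hab ω p.2 p'.2
    rw [← one_add_combo p.1 p'.1 hab] at h
    have h2 := div_le_div_of_nonneg_right h (zero_le_two (α := ℝ))
    rw [add_div, mul_div_assoc, mul_div_assoc] at h2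
    exact h2

/-- The transport problem of density matrices `1 + x`, with `x` hermitian of trace zero. -/
noncomputable def densityTransport [Nonempty N] (ε : ℝ)
    (hstinv : ∀ j, st (st j) = j) (hVst : ∀ j, Vf (st j) = (Vf j)ᴴ)
    (hωst : ∀ j, ω (st j) = -ω j)
    (herg : ∀ A : Matrix N N ℂ, genL Vf ω A = 0 → ∃ c : ℂ, A = c • (1 : Matrix N N ℂ))
    (hdvg : ∀ (W : J → Matrix N N ℂ) (B : Matrix N N ℂ),
      gns (dvg W) B = -∑ j, gns (W j) (Vf j * B - B * Vf j))
    (hLdag : ∀ ρ B : Matrix N N ℂ, gns (Ldag ρ) B = gns ρ (genL Vf ω B)) :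
    TransportProblem (StateSpace N) (FluxSpace N st) where
  Ω := {x | (1 + (x : Matrix N N ℂ)).PosDef}
  D := LinearMap.toContinuousLinearMap (dvgLin hstinv hVst hdvg)
  Λ := LinearMap.toContinuousLinearMap (LdagLin ε hstinv hVst hωst hLdag)
  b := ε • ⟨Ldag 1, isHermitian_Ldag hstinv hVst hωst hLdag Matrix.isHermitian_one,
    tau_Ldag hLdag 1⟩
  q x V := invActionH ω (1 + (x : Matrix N N ℂ)) (V : J → Matrix N N ℂ) / 2
  c := (Fintype.card N * (∑ j, Real.exp |ω j| + 1) * Fintype.card N)⁻¹ / 2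
  isOpen := isOpen_posDef_one_add
  isBounded := isBounded_posDef_one_add
  surjective := surjective_dvgLin hstinv hVst hdvg herg
  convexOn := convexOn_invActionH st ω
  homogeneous x hx r V := by
    rw [← mul_div_assoc]
    exact congrArg (· / 2) (Matrix.PosDef.invActionH_smul hx ω r V)
  c_pos := by
    have hn : (0:ℝ) < Fintype.card N := by exact_mod_cast Fintype.card_pos
    positivity
  coercive x hx V := by
    have h := div_le_div_of_nonneg_right (Matrix.PosDef.le_invActionH hx (tau_one_add x) ω V)
      (zero_le_two (α := ℝ))
    refine le_trans (le_of_eq ?_) h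
    rw [Submodule.coe_norm]
    ring

end Operators

/-- The real trace pairing on trace-free hermitian matrices. -/
noncomputable def tracePairing (N : Type*) [Fintype N] :
    StateSpace N →ₗ[ℝ] Module.Dual ℝ (StateSpace N) :=
  LinearMap.mk₂ ℝ (fun x y => (tau ((x : Matrix N N ℂ) * (y : Matrix N N ℂ))).re)
    (fun x y z => by
      rw [Submodule.coe_add, Matrix.add_mul, tau_add, Complex.add_re])
    (fun r x y => by
      rw [Submodule.coe_smul, Matrix.smul_mul, tau_smul, Complex.re_ofReal_mul, smul_eq_mul])
    (fun x y z => by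
      rw [Submodule.coe_add, Matrix.mul_add, tau_add, Complex.add_re])
    (fun r x y => by
      rw [Submodule.coe_smul, Matrix.mul_smul, tau_smul, Complex.re_ofReal_mul, smul_eq_mul])

lemma surjective_tracePairing : Function.Surjective (tracePairing N) := by
  rw [← LinearMap.injective_iff_surjective_of_finrank_eq_finrank
    (Subspace.dual_finrank_eq (K := ℝ) (V := StateSpace N)).symm, injective_iff_map_eq_zero]
  intro x hx
  refine Subtype.ext (eq_zero_of_re_gns_self ?_)
  rw [← tau_mul_of_isHermitian x.2.1]
  exact LinearMap.congr_fun hx x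

end TransportInstance

/-- Subsolutions represented by a nondegenerate pairing. -/
lemma TransportProblem.IsLowerBound.exists_subsolution_of_pairing {F H : Type*}
    [NormedAddCommGroup F] [NormedSpace ℝ F] [FiniteDimensional ℝ F]
    [NormedAddCommGroup H] [NormedSpace ℝ H] [FiniteDimensional ℝ H] {T : TransportProblem F H}
    {β : F →ₗ[ℝ] Module.Dual ℝ F} (hβ : Function.Surjective β) {x₀ x₁ : F} {P : ℝ}
    (hP : T.IsLowerBound x₀ x₁ P) (h₀ : x₀ ∈ T.Ω) (h₁ : x₁ ∈ T.Ω) {κ : ℝ} (hκ : 0 < κ) :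
    ∃ (B B' : ℝ → F) (a a' : ℝ → ℝ), (∀ s, HasDerivAt B (B' s) s) ∧
      (∀ s, HasDerivAt a (a' s) s) ∧ Continuous B' ∧ Continuous a' ∧
      (∀ s, ∀ x ∈ T.Ω, ∀ v, β (B' s) x + a' s + β (B s) (T.Λ x + T.b) - β (B s) (T.D v) -
        T.q x v ≤ 0) ∧
      P - κ ≤ β (B 1) x₁ + a 1 - (β (B 0) x₀ + a 0) := by
  obtain ⟨φ, φ', a, a', hφ, ha, hφ', ha', hsub, hval⟩ := hP.exists_subsolution h₀ h₁ hκ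
  obtain ⟨S, hS⟩ := β.exists_rightInverse_of_surjective (LinearMap.range_eq_top.2 hβ)
  let R : (F →L[ℝ] ℝ) →L[ℝ] F := LinearMap.toContinuousLinearMap
    (S ∘ₗ (LinearMap.toContinuousLinearMap (𝕜 := ℝ) (E := F) (F' := ℝ)).symm.toLinearMap)
  have hR : ∀ ψ x, β (R ψ) x = ψ x := fun ψ x =>
    LinearMap.congr_fun (LinearMap.congr_fun hS (ψ : F →ₗ[ℝ] ℝ)) x
  refine ⟨fun s => R (φ s), fun s => R (φ' s), a, a',
    fun s => R.hasFDerivAt.comp_hasDerivAt s (hφ s), ha, R.continuous.comp hφ', ha', ?_, ?_⟩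
  · simpa only [hR] using hsub
  · simpa only [hR] using hval

section StrongDuality

attribute [local instance] Matrix.normedAddCommGroup Matrix.normedSpace

variable {N : Type*} [Fintype N] [DecidableEq N] {J : Type*} [Fintype J]

/-- `T` is the transport problem of density matrices for the given operators. -/
structure IsDensityTransport {st : J → J} (T : TransportProblem (StateSpace N) (FluxSpace N st))
    (ω : J → ℝ) (dvg : (J → Matrix N N ℂ) → Matrix N N ℂ) (Ldag : Matrix N N ℂ → Matrix N N ℂ)
    (ε : ℝ) : Prop where
  mem_iff : ∀ x, x ∈ T.Ω ↔ (1 + (x : Matrix N N ℂ)).PosDef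
  coe_D : ∀ V, (T.D V : Matrix N N ℂ) = dvg V
  coe_drift : ∀ x, ((T.Λ x + T.b : StateSpace N) : Matrix N N ℂ) =
    ε • Ldag (1 + (x : Matrix N N ℂ))
  q_eq : ∀ x V, T.q x V =
    invActionH ω (1 + (x : Matrix N N ℂ)) (V : J → Matrix N N ℂ) / 2

lemma isDensityTransport_densityTransport [Nonempty N] {st : J → J} {Vf : J → Matrix N N ℂ}
    {ω : J → ℝ} {dvg : (J → Matrix N N ℂ) → Matrix N N ℂ} {Ldag : Matrix N N ℂ → Matrix N N ℂ}
    (ε : ℝ) (hstinv : ∀ j, st (st j) = j) (hVst : ∀ j, Vf (st j) = (Vf j)ᴴ)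
    (hωst : ∀ j, ω (st j) = -ω j)
    (herg : ∀ A : Matrix N N ℂ, genL Vf ω A = 0 → ∃ c : ℂ, A = c • (1 : Matrix N N ℂ))
    (hdvg : ∀ (W : J → Matrix N N ℂ) (B : Matrix N N ℂ),
      gns (dvg W) B = -∑ j, gns (W j) (Vf j * B - B * Vf j))
    (hLdag : ∀ ρ B : Matrix N N ℂ, gns (Ldag ρ) B = gns ρ (genL Vf ω B)) :
    IsDensityTransport (densityTransport ε hstinv hVst hωst herg hdvg hLdag) ω dvg Ldag ε where
  mem_iff _ := Iff.rfl
  coe_D _ := rfl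
  coe_drift x := by
    change ε • Ldag (x : Matrix N N ℂ) + ε • Ldag 1 = _
    rw [Ldag_add hLdag, smul_add, add_comm]
  q_eq _ _ := rfl

lemma hasDerivAt_stateSpace_apply {f : ℝ → StateSpace N} {f' : StateSpace N} {t : ℝ}
    (hf : HasDerivAt f f' t) (i k : N) :
    HasDerivAt (fun s => (f s : Matrix N N ℂ) i k) ((f' : Matrix N N ℂ) i k) t := by
  have h : HasDerivAt (fun s => (f s : Matrix N N ℂ)) (f' : Matrix N N ℂ) t :=
    (StateSpace N).subtypeL.hasFDerivAt.comp_hasDerivAt t hf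
  exact hasDerivAt_pi.1 (hasDerivAt_pi.1 h i) k

lemma continuous_stateSpace_apply {f : ℝ → StateSpace N} (hf : Continuous f) (i k : N) :
    Continuous fun s => (f s : Matrix N N ℂ) i k :=
  (continuous_subtype_val.comp hf).matrix_elem i k

/-- The trace-free part of a density matrix. -/
noncomputable def tracelessPart [Nonempty N] {ρ : Matrix N N ℂ} (hρ : ρ.IsHermitian)
    (ht : tau ρ = 1) : StateSpace N :=
  ⟨ρ - 1, hρ.sub Matrix.isHermitian_one, by
    have := tau_add (ρ - 1) 1
    rw [sub_add_cancel, ht, tau_one] at this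
    linear_combination -this⟩

lemma one_add_tracelessPart [Nonempty N] {ρ : Matrix N N ℂ} (hρ : ρ.IsHermitian)
    (ht : tau ρ = 1) : 1 + (tracelessPart hρ ht : Matrix N N ℂ) = ρ :=
  add_sub_cancel _ _

lemma re_tau_add_smul_one_mul [Nonempty N] (B x : StateSpace N) (a : ℝ) :
    (tau (((B : Matrix N N ℂ) + a • 1) * (1 + (x : Matrix N N ℂ)))).re =
      (tau ((B : Matrix N N ℂ) * (x : Matrix N N ℂ))).re + a := by
  rw [Matrix.add_mul, Matrix.mul_add, Matrix.mul_one, Matrix.smul_mul, Matrix.one_mul, tau_add,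
    tau_add, tau_smul, tau_one_add, B.2.2]
  simp

lemma re_tau_sub (A B : Matrix N N ℂ) : (tau (A - B)).re = (tau A).re - (tau B).re := by
  rw [tau, Matrix.trace_sub, sub_div, Complex.sub_re, ← tau, ← tau]

lemma gradD_add_smul_one (Vf : J → Matrix N N ℂ) (A : Matrix N N ℂ) (a : ℝ) :
    gradD Vf (A + a • 1) = gradD Vf A := by
  rw [gradD_add, gradD_smul, gradD_one, smul_zero, add_zero]

lemma genL_add_smul_one (Vf : J → Matrix N N ℂ) (ω : J → ℝ) (A : Matrix N N ℂ) (a : ℝ) :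
    genL Vf ω (A + a • 1) = genL Vf ω A := by
  have h : ∀ j, (A + a • (1 : Matrix N N ℂ)) * Vf j - Vf j * (A + a • 1) =
      A * Vf j - Vf j * A := fun j => by
    simp only [Matrix.add_mul, Matrix.mul_add, Matrix.smul_mul, Matrix.mul_smul, Matrix.one_mul,
      Matrix.mul_one]
    abel
  simp only [genL, h]

lemma re_gnsH_comm (V W : J → Matrix N N ℂ) : (gnsH V W).re = (gnsH W V).re := by
  simp only [gnsH_re]
  refine Finset.sum_congr rfl fun j _ => ?_
  rw [← gns_star, Complex.star_def, Complex.conj_re]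

/-- The Hamilton–Jacobi–Bellman inequality extends from positive definite to all density
matrices. -/
lemma hjb_le_of_forall_posDef [Nonempty N] {ω : J → ℝ} {C : Matrix N N ℂ} {G : J → Matrix N N ℂ}
    (h : ∀ ρ : Matrix N N ℂ, ρ.PosDef → tau ρ = 1 →
      (tau (C * ρ)).re + (1/2) * (gnsH G (opOmega ω ρ G)).re ≤ 0)
    {ρ : Matrix N N ℂ} (hρ : ρ.PosSemidef) (ht : tau ρ = 1) :
    (tau (C * ρ)).re + (1/2) * (gnsH G (opOmega ω ρ G)).re ≤ 0 := by
  set K := (tau (C * ρ)).re + (1/2) * (gnsH G (opOmega ω ρ G)).re with hK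
  have key : ∀ r ∈ Set.Ioo (0:ℝ) 1, (1 - r) * K + r * (tau C).re ≤ 0 := by
    rintro r ⟨hr, hr1⟩
    have hpos : ((1 - r) • ρ + r • (1 : Matrix N N ℂ)).PosDef :=
      Matrix.PosDef.posSemidef_add (hρ.smul (by linarith)) (Matrix.PosDef.one.smul hr)
    have h1 := h _ hpos (by rw [tau_add, tau_smul, tau_smul, ht, tau_one]; simp)
    have h2 : (1 - r) * (gnsH G (opOmega ω ρ G)).re ≤
        (gnsH G (opOmega ω ((1 - r) • ρ + r • (1 : Matrix N N ℂ)) G)).re := by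
      rw [gnsH_re, gnsH_re, Finset.mul_sum]
      have hd := hρ.isHermitian.diagonalizes
      exact Finset.sum_le_sum fun j _ =>
        hd.sandwich_interpolate (hd.nonneg hρ) (ω j) (G j) hr hr1
    rw [Matrix.mul_add, Matrix.mul_smul, Matrix.mul_smul, Matrix.mul_one, tau_add, tau_smul,
      tau_smul, Complex.add_re, Complex.re_ofReal_mul, Complex.re_ofReal_mul] at h1
    rw [hK]
    linarith
  have hlim : Filter.Tendsto (fun r : ℝ => (1 - r) * K + r * (tau C).re) (nhdsWithin 0 (Set.Ioi 0))
      (nhds K) := by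
    have : Continuous fun r : ℝ => (1 - r) * K + r * (tau C).re := by fun_prop
    simpa using (this.tendsto 0).mono_left nhdsWithin_le_nhds
  exact le_of_tendsto hlim (Filter.mem_of_superset (Ioo_mem_nhdsGT zero_lt_one) key)

namespace IsDensityTransport

variable {st : J → J} {T : TransportProblem (StateSpace N) (FluxSpace N st)}
  {Vf : J → Matrix N N ℂ} {ω : J → ℝ} {ε : ℝ}
  {dvg : (J → Matrix N N ℂ) → Matrix N N ℂ} {Ldag : Matrix N N ℂ → Matrix N N ℂ}

lemma isCE [Nonempty N] (hT : IsDensityTransport T ω dvg Ldag ε) {x : ℝ → StateSpace N}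
    {v : ℝ → FluxSpace N st} (h : T.Admissible x v)
    (hdef : ∀ t ∈ Set.Icc (0:ℝ) 1, T.defect x v t = 0) :
    IsCE dvg Ldag ε (1 + (x 0 : Matrix N N ℂ)) (1 + (x 1 : Matrix N N ℂ))
      (fun t => 1 + (x t : Matrix N N ℂ)) (fun t => (v t : J → Matrix N N ℂ)) := by
  have hd := h.contDiff.differentiable one_ne_zero
  refine ⟨rfl, rfl, fun t _ => ⟨(hT.mem_iff _).1 (h.mem t), tau_one_add _⟩, fun j i k => ?_,
    fun t => (deriv x t : StateSpace N), fun t _ i k => ?_, fun i k => ?_, fun t ht => ?_⟩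
  · exact (((continuous_apply j).comp (continuous_subtype_val.comp h.continuous)).matrix_elem
      i k).continuousOn
  · exact (hasDerivAt_stateSpace_apply (hd t).hasDerivAt i k).const_add _
  · exact (continuous_stateSpace_apply (h.contDiff.continuous_deriv le_rfl) i k).continuousOn
  · rw [← hT.coe_D, ← hT.coe_drift, ← Submodule.coe_add]
    exact congrArg Subtype.val (sub_eq_zero.1 (hdef t ht))

lemma Wsq_le [Nonempty N] (hT : IsDensityTransport T ω dvg Ldag ε) {x : ℝ → StateSpace N}
    {v : ℝ → FluxSpace N st} (h : T.Admissible x v)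
    (hdef : ∀ t ∈ Set.Icc (0:ℝ) 1, T.defect x v t = 0) :
    Wsq ω dvg Ldag ε (1 + (x 0 : Matrix N N ℂ)) (1 + (x 1 : Matrix N N ℂ)) ≤
      ENNReal.ofReal (2 * ∫ t in (0:ℝ)..1, T.q (x t) (v t)) := by
  refine (iInf₂_le_of_le _ _ (iInf_le _ (hT.isCE h hdef))).trans (le_of_eq ?_)
  have hcont := (T.continuous_q_comp h.contDiff.continuous h.continuous h.mem).const_mul 2
  rw [← intervalIntegral.integral_const_mul, intervalIntegral.integral_of_le zero_le_one,
    ← integral_Icc_eq_integral_Ioc, ofReal_integral_eq_lintegral_ofReal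
      (hcont.integrableOn_Icc) (Filter.Eventually.of_forall fun t =>
        mul_nonneg zero_le_two (T.q_nonneg (h.mem t) _))]
  refine lintegral_congr fun t => ?_
  rw [((hT.mem_iff _).1 (h.mem t)).invQuadH_eq, hT.q_eq]
  congr 1
  ring

lemma Wsq_ne_top [Nonempty N] (hT : IsDensityTransport T ω dvg Ldag ε) {x₀ x₁ : StateSpace N}
    (h₀ : x₀ ∈ T.Ω) (h₁ : x₁ ∈ T.Ω) :
    Wsq ω dvg Ldag ε (1 + (x₀ : Matrix N N ℂ)) (1 + (x₁ : Matrix N N ℂ)) ≠ ⊤ := by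
  obtain ⟨x, hx, rfl, rfl⟩ := T.exists_admissible h₀ h₁
  obtain ⟨R, hR⟩ := T.exists_rightInverse
  have hc := hx.contDiff.continuous
  have hc' := hx.contDiff.continuous_deriv le_rfl
  have hv : T.Admissible x fun t => R (T.Λ (x t) + T.b - deriv x t) :=
    ⟨hx.contDiff, by fun_prop, hx.mem⟩
  refine ((hT.Wsq_le hv fun t _ => ?_).trans_lt ENNReal.ofReal_lt_top).ne
  exact sub_eq_zero.2 ((congrArg (deriv x t + ·) (hR _)).trans (add_sub_cancel _ _))

lemma isLowerBound [Nonempty N] (hT : IsDensityTransport T ω dvg Ldag ε) (x₀ x₁ : StateSpace N) :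
    T.IsLowerBound x₀ x₁
      (Wsq ω dvg Ldag ε (1 + (x₀ : Matrix N N ℂ)) (1 + (x₁ : Matrix N N ℂ)) / 2).toReal := by
  rintro x v h rfl rfl hdef
  have h0 : 0 ≤ ∫ t in (0:ℝ)..1, T.q (x t) (v t) :=
    intervalIntegral.integral_nonneg zero_le_one fun t _ => T.q_nonneg (h.mem t) _
  refine ENNReal.toReal_le_of_le_ofReal h0 ?_
  rw [ENNReal.div_le_iff two_ne_zero ENNReal.ofNat_ne_top, mul_comm]
  refine (hT.Wsq_le h hdef).trans (le_of_eq ?_)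
  rw [ENNReal.ofReal_mul zero_le_two, ENNReal.ofReal_ofNat]

lemma exists_isHJB [Nonempty N] (hT : IsDensityTransport T ω dvg Ldag ε)
    (hVst : ∀ j, Vf (st j) = (Vf j)ᴴ) (hωst : ∀ j, ω (st j) = -ω j)
    (hdvg : ∀ (W : J → Matrix N N ℂ) (B : Matrix N N ℂ),
      gns (dvg W) B = -∑ j, gns (W j) (Vf j * B - B * Vf j))
    (hLdag : ∀ ρ B : Matrix N N ℂ, gns (Ldag ρ) B = gns ρ (genL Vf ω B))
    {x₀ x₁ : StateSpace N} (h₀ : x₀ ∈ T.Ω) (h₁ : x₁ ∈ T.Ω) {P κ : ℝ}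
    (hP : T.IsLowerBound x₀ x₁ P) (hκ : 0 < κ) :
    ∃ A A' : ℝ → Matrix N N ℂ, IsHJB Vf ω ε A A' ∧
      P - κ ≤ (tau (A 1 * (1 + (x₁ : Matrix N N ℂ)) - A 0 * (1 + (x₀ : Matrix N N ℂ)))).re := by
  obtain ⟨B, B', a, a', hB, ha, hB', ha', hsub, hval⟩ :=
    hP.exists_subsolution_of_pairing (β := tracePairing N) (surjective_tracePairing (N := N)) h₀ h₁
      hκ
  have hpair : ∀ x y : StateSpace N, tracePairing N x y =
    (tau ((x : Matrix N N ℂ) * (y : Matrix N N ℂ))).re := fun x y => rfl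
  refine ⟨fun t => (B t : Matrix N N ℂ) + a t • 1,
    fun t => (B' t : Matrix N N ℂ) + a' t • 1, ⟨fun t _ => ?_, fun t _ i k => ?_, fun i k => ?_,
      fun t _ ρ hρ ht => ?_⟩, ?_⟩
  · refine (B t).2.1.add ?_
    rw [Matrix.IsHermitian, conjTranspose_smul, conjTranspose_one, star_trivial]
  · have h1 : HasDerivAt B (B' t) t := hB t
    have h2 : HasDerivAt (fun s => a s • (1 : Matrix N N ℂ) i k) (a' t • (1 : Matrix N N ℂ) i k) t :=
      (ha t).smul_const _
    exact (hasDerivAt_stateSpace_apply h1 i k).add h2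
  · exact ((continuous_stateSpace_apply hB' i k).add
      (ha'.smul continuous_const)).continuousOn
  · rw [gradD_add_smul_one, genL_add_smul_one]
    refine hjb_le_of_forall_posDef (fun ρ hρ ht => ?_) hρ ht
    have hBt := (B t).2.1
    obtain ⟨x, rfl⟩ : ∃ x : StateSpace N, 1 + (x : Matrix N N ℂ) = ρ :=
      ⟨_, one_add_tracelessPart hρ.isHermitian ht⟩
    set G := gradD Vf (B t : Matrix N N ℂ) with hG
    let V : FluxSpace N st := ⟨opOmega ω (1 + (x : Matrix N N ℂ)) G,
      hρ.posSemidef.opOmega_symm hωst (hBt.gradD_symm hVst)⟩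
    have h := hsub t x ((hT.mem_iff x).2 hρ) V
    have h1 : tracePairing N (B t) (T.Λ x + T.b) =
        (tau ((B t : Matrix N N ℂ) * ε • Ldag (1 + (x : Matrix N N ℂ)))).re :=
      congrArg (fun M => (tau ((B t : Matrix N N ℂ) * M)).re) (hT.coe_drift x)
    have h2 : tracePairing N (B t) (T.D V) =
        (tau ((B t : Matrix N N ℂ) * dvg V)).re :=
      congrArg (fun M => (tau ((B t : Matrix N N ℂ) * M)).re) (hT.coe_D V)
    have h3 : (gnsH G (V : J → Matrix N N ℂ)).re / 2 = T.q x V := by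
      rw [hT.q_eq, ← hρ.re_gnsH_opOmega]
    have h4 := re_tau_mul_drift hdvg hLdag hBt hρ.isHermitian ε V
    rw [Matrix.mul_sub, re_tau_sub, re_gnsH_comm] at h4
    have h5 := hpair (B' t) x
    rw [Matrix.add_mul, tau_add, Complex.add_re, re_tau_add_smul_one_mul, Matrix.smul_mul,
      tau_smul, Complex.re_ofReal_mul]
    change _ + (1/2) * (gnsH G (V : J → Matrix N N ℂ)).re ≤ 0
    linarith
  · rw [re_tau_sub, re_tau_add_smul_one_mul, re_tau_add_smul_one_mul]
    exact hval

end IsDensityTransport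

end StrongDuality

/-- **Duality formula for the entropic noncommutative transport distance** (Wirth).
Let `ε ≥ 0` and `ρ₀, ρ₁` invertible density matrices.  Assume the Lindblad data
`(V_j, ω_j)` is as in Alicki's theorem, `σ`-detailed balance holds for an invertible
density matrix `σ`, and the generator `L` is ergodic.  Then
`½ W_ε²(ρ₀,ρ₁) = sup { τ(A(1)ρ₁ - A(0)ρ₀) : A ∈ HJB_ε }`. -/
theorem duality_formula
    {N : Type*} [Fintype N] [DecidableEq N] {J : Type*} [Fintype J]
    (ε : ℝ) (hε : 0 ≤ ε)
    (st : J → J) (Vf : J → Matrix N N ℂ) (ω : J → ℝ)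
    (hON : ∀ j k, tau ((Vf j)ᴴ * Vf k) = if j = k then 1 else 0)
    (htr : ∀ j, tau (Vf j) = 0)
    (hstinv : ∀ j, st (st j) = j)
    (hVst : ∀ j, Vf (st j) = (Vf j)ᴴ)
    (hωst : ∀ j, ω (st j) = -ω j)
    (σ : Matrix N N ℂ) (hσ : σ.PosDef) (hσtr : tau σ = 1)
    (hDBC : ∀ j, σ * Vf j = Real.exp (-ω j) • (Vf j * σ))
    (herg : ∀ A : Matrix N N ℂ, genL Vf ω A = 0 → ∃ c : ℂ, A = c • (1 : Matrix N N ℂ))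
    (dvg : (J → Matrix N N ℂ) → Matrix N N ℂ)
    (hdvg : ∀ (W : J → Matrix N N ℂ) (B : Matrix N N ℂ),
      gns (dvg W) B = -∑ j, gns (W j) (Vf j * B - B * Vf j))
    (Ldag : Matrix N N ℂ → Matrix N N ℂ)
    (hLdag : ∀ ρ B : Matrix N N ℂ, gns (Ldag ρ) B = gns ρ (genL Vf ω B))
    (ρ₀ ρ₁ : Matrix N N ℂ)
    (h₀ : ρ₀.PosDef) (h₀tr : tau ρ₀ = 1) (h₁ : ρ₁.PosDef) (h₁tr : tau ρ₁ = 1) :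
    Wsq ω dvg Ldag ε ρ₀ ρ₁ / 2 =
      ⨆ (A : ℝ → Matrix N N ℂ) (A' : ℝ → Matrix N N ℂ) (_ : IsHJB Vf ω ε A A'),
        ENNReal.ofReal (tau (A 1 * ρ₁ - A 0 * ρ₀)).re := by
  have : Nonempty N := by
    by_contra hN
    rw [not_nonempty_iff] at hN
    simp [tau] at hσtr
  have hT := isDensityTransport_densityTransport ε hstinv hVst hωst herg hdvg hLdag
  obtain ⟨x₀, rfl⟩ : ∃ x : StateSpace N, 1 + (x : Matrix N N ℂ) = ρ₀ :=
    ⟨_, one_add_tracelessPart h₀.isHermitian h₀tr⟩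
  obtain ⟨x₁, rfl⟩ : ∃ x : StateSpace N, 1 + (x : Matrix N N ℂ) = ρ₁ :=
    ⟨_, one_add_tracelessPart h₁.isHermitian h₁tr⟩
  have hx₀ := (hT.mem_iff x₀).2 h₀
  have hx₁ := (hT.mem_iff x₁).2 h₁
  refine le_antisymm ?_ ?_
  · refine ENNReal.le_of_forall_pos_le_add fun κ hκ _ => ?_
    obtain ⟨A, A', hA, hval⟩ := hT.exists_isHJB hVst hωst hdvg hLdag hx₀ hx₁
      (hT.isLowerBound x₀ x₁) (NNReal.coe_pos.2 hκ)
    rw [← ENNReal.ofReal_toReal (ENNReal.div_ne_top (hT.Wsq_ne_top hx₀ hx₁) two_ne_zero)]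
    refine (ENNReal.ofReal_le_ofReal (sub_le_iff_le_add.1 hval)).trans
      (ENNReal.ofReal_add_le.trans ?_)
    rw [ENNReal.ofReal_coe_nnreal]
    exact add_le_add_left (le_iSup₂_of_le A A' (le_iSup (fun _ : IsHJB Vf ω ε A A' =>
      ENNReal.ofReal (tau (A 1 * (1 + (x₁ : Matrix N N ℂ)) -
        A 0 * (1 + (x₀ : Matrix N N ℂ)))).re) hA)) _
  · refine iSup₂_le fun A A' => iSup_le fun hA => ?_
    rw [ENNReal.le_div_iff_mul_le (Or.inl two_ne_zero) (Or.inl ENNReal.ofNat_ne_top)]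
    exact le_iInf₂ fun ρ V => le_iInf fun hρ => hA.ofReal_le hdvg hLdag hρ
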